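/- arXiv:1310.0597 — 14 statements merged into one kernel-verified Lean document; each statement's English description precedes it below -/
import Mathlib

section
/- Let p, q ∈ (1,∞), set p' = p/(p−1) and r = max{p', q}, and let k ∈ (0,1). If (1/q)·B(1/r, 1/r) < 8/(π² − 8) and (∫₀^{k^{q/r}} (1 − s^r)^{−1} ds) / k^{q/r} ≤ (8q/(π² − 8))·B(1/r, 1/r)^{−1}, then K_{pq}(k) < 8/(π² − 8). -/
open Real intervalIntegral

/-- The generalized complete elliptic integral
`K_{pq}(k) = ∫₀¹ (1−t^q)^{−1/p} (1−k^q t^q)^{−1/p'} dt` with `p' = p/(p−1)`. -/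
noncomputable def Kpq (p q k : ℝ) : ℝ :=
  ∫ t in (0:ℝ)..1, (1 - t ^ q) ^ (-(1 / p)) * (1 - k ^ q * t ^ q) ^ (-(1 / (p / (p - 1))))

/-- The Euler Beta function `B(x,y) = ∫₀¹ t^{x−1}(1−t)^{y−1} dt`. -/
noncomputable def BetaFn (x y : ℝ) : ℝ :=
  ∫ t in (0:ℝ)..1, t ^ (x - 1) * (1 - t) ^ (y - 1)

open MeasureTheory

lemma one_sub_rpow_neg_hasSum (e : ℝ) {x : ℝ} (hx : |x| < 1) :
    HasSum (fun n : ℕ ↦ Ring.multichoose e n * x ^ n) ((1 - x) ^ (-e)) := by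
  have h := (Real.one_div_one_sub_rpow_hasFPowerSeriesOnBall_zero e).hasSum
    (y := x) (by simpa [enorm_eq_nnnorm, ← NNReal.coe_lt_coe] using hx)
  have h1 : 0 ≤ 1 - x := by linarith [le_abs_self x]
  rw [Real.rpow_neg h1]
  have hn (n : ℕ) : e + n - 1 - n + 1 = e := by ring
  simpa [Ring.choose, mul_comm, hn] using h

lemma succ_mul_multichoose (e : ℝ) (n : ℕ) :
    (n + 1 : ℝ) * Ring.multichoose e (n + 1) = (e + n) * Ring.multichoose e n := by
  have h0 := Ring.factorial_nsmul_multichoose_eq_ascPochhammer e n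
  have h1 := Ring.factorial_nsmul_multichoose_eq_ascPochhammer e (n + 1)
  rw [ascPochhammer_succ_right, Polynomial.smeval_mul, Polynomial.smeval_add, ← h0] at h1
  simp only [Nat.factorial_succ, nsmul_eq_mul, Polynomial.smeval_X, pow_one,
    Polynomial.smeval_natCast, pow_zero, Nat.cast_mul, Nat.cast_add, Nat.cast_one, mul_one] at h1
  have hf : (n.factorial : ℝ) ≠ 0 := by exact_mod_cast n.factorial_ne_zero
  apply mul_left_cancel₀ hf
  linear_combination h1

lemma multichoose_nonneg {e : ℝ} (he : 0 ≤ e) (n : ℕ) : 0 ≤ Ring.multichoose e n := by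
  induction n with
  | zero => simp
  | succ n ih =>
    have h := succ_mul_multichoose e n
    have : 0 ≤ (n + 1 : ℝ) * Ring.multichoose e (n + 1) := by rw [h]; positivity
    exact nonneg_of_mul_nonneg_right this (by positivity)

lemma ofReal_beta_integrand {x : ℝ} (hx : x ∈ Set.Ioc (0 : ℝ) 1) (u v : ℝ) :
    (x : ℂ) ^ ((u : ℂ) - 1) * (1 - (x : ℂ)) ^ ((v : ℂ) - 1)
      = ((x ^ (u - 1) * (1 - x) ^ (v - 1) : ℝ) : ℂ) := by
  have h1 : 0 ≤ 1 - x := by linarith [hx.2]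
  rw [Complex.ofReal_mul, Complex.ofReal_cpow hx.1.le, Complex.ofReal_cpow h1]
  push_cast
  rfl

lemma integrableOn_beta {u v : ℝ} (hu : 0 < u) (hv : 0 < v) :
    IntegrableOn (fun x : ℝ ↦ x ^ (u - 1) * (1 - x) ^ (v - 1)) (Set.Ioc 0 1) := by
  have h := Complex.betaIntegral_convergent (u := u) (v := v) (by simpa) (by simpa)
  rw [intervalIntegrable_iff_integrableOn_Ioc_of_le zero_le_one] at h
  have h2 : IntegrableOn (fun x : ℝ ↦ ((x ^ (u - 1) * (1 - x) ^ (v - 1) : ℝ) : ℂ))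
      (Set.Ioc 0 1) :=
    h.congr_fun (fun x hx ↦ ofReal_beta_integrand hx u v) measurableSet_Ioc
  simpa using! h2.re

lemma betaFn_eq_beta {u v : ℝ} (hu : 0 < u) (hv : 0 < v) :
    BetaFn u v = ProbabilityTheory.beta u v := by
  rw [ProbabilityTheory.beta_eq_betaIntegralReal u v hu hv, Complex.betaIntegral, BetaFn,
    ← Complex.ofReal_re (∫ t in (0:ℝ)..1, t ^ (u - 1) * (1 - t) ^ (v - 1)),
    ← intervalIntegral.integral_ofReal]
  congr 1
  simp_rw [intervalIntegral.integral_of_le zero_le_one]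
  exact (setIntegral_congr_fun measurableSet_Ioc
    (fun x hx ↦ ofReal_beta_integrand hx u v)).symm

lemma betaFn_pos {u v : ℝ} (hu : 0 < u) (hv : 0 < v) : 0 < BetaFn u v :=
  betaFn_eq_beta hu hv ▸ ProbabilityTheory.beta_pos hu hv

lemma betaFn_add_one_left {u v : ℝ} (hu : 0 < u) (hv : 0 < v) :
    (u + v) * BetaFn (u + 1) v = u * BetaFn u v := by
  rw [betaFn_eq_beta hu hv, betaFn_eq_beta (by positivity) hv, ProbabilityTheory.beta,
    ProbabilityTheory.beta, Real.Gamma_add_one hu.ne', add_right_comm,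
    Real.Gamma_add_one (by positivity)]
  have := (Real.Gamma_pos_of_pos (add_pos hu hv)).ne'
  field_simp

lemma multichoose_mul_betaFn_le {e : ℝ} (he0 : 0 < e) (he1 : e ≤ 1) (n : ℕ) :
    Ring.multichoose e n * BetaFn (e + n) e ≤ BetaFn e e * (e / (e + n)) := by
  induction n with
  | zero => simp [he0.ne']
  | succ n ih =>
    have h1 := succ_mul_multichoose e n
    have h2 := betaFn_add_one_left (show 0 < e + n by positivity) he0
    have hB := betaFn_pos he0 he0
    have e1 : Ring.multichoose e (n + 1) = (e + n) * Ring.multichoose e n / (n + 1) := by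
      field_simp; linarith
    have e2 : BetaFn (e + (n + 1 : ℕ)) e = (e + n) * BetaFn (e + n) e / (e + n + e) := by
      push_cast; rw [← add_assoc]; field_simp; linarith
    rw [e1, e2]
    calc _ = (Ring.multichoose e n * BetaFn (e + n) e) *
          ((e + n) ^ 2 / ((n + 1) * (e + n + e))) := by field_simp
      _ ≤ BetaFn e e * (e / (e + n)) * ((e + n) ^ 2 / ((n + 1) * (e + n + e))) := by gcongr
      _ = BetaFn e e * (e * ((e + n) / ((n + 1) * (e + n + e)))) := by field_simp
      _ ≤ BetaFn e e * (e / (e + (n + 1 : ℕ))) := by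
        rw [div_eq_mul_one_div e]
        refine mul_le_mul_of_nonneg_left (mul_le_mul_of_nonneg_left ?_ he0.le) hB.le
        rw [div_le_div_iff₀ (by positivity) (by positivity)]
        push_cast
        nlinarith

lemma multichoose_one_mul_betaFn_lt {e : ℝ} (he0 : 0 < e) (he1 : e < 1) :
    Ring.multichoose e 1 * BetaFn (e + 1) e < BetaFn e e * (e / (e + 1)) := by
  have h := betaFn_add_one_left he0 he0
  have hB := betaFn_pos he0 he0
  have e2 : BetaFn (e + 1) e = BetaFn e e / 2 := by
    apply mul_left_cancel₀ he0.ne'; linarith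
  rw [e2, Ring.multichoose_one_right, mul_div_left_comm]
  gcongr
  linarith

lemma hasSum_integral_inv_one_sub_rpow {r a : ℝ} (hr : 0 < r) (ha0 : 0 < a) (ha1 : a < 1) :
    HasSum (fun n : ℕ ↦ (1 / r) / (1 / r + n) * (a ^ r) ^ n)
      ((∫ s in (0:ℝ)..a, (1 - s ^ r)⁻¹) / a) := by
  have har1 : a ^ r < 1 := Real.rpow_lt_one ha0.le ha1 hr
  have har0 : 0 < a ^ r := Real.rpow_pos_of_pos ha0 r
  have key : ∀ n : ℕ, ∫ s in Set.Ioc 0 a, (s ^ r) ^ n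
      = (1 / r) / (1 / r + n) * (a ^ r) ^ n * a := by
    intro n
    have h : ∀ s ∈ Set.Ioc 0 a, (s ^ r) ^ n = s ^ (r * n) := fun s hs ↦ by
      rw [Real.rpow_mul hs.1.le, Real.rpow_natCast]
    have hn : 0 ≤ r * n := by positivity
    rw [setIntegral_congr_fun measurableSet_Ioc h, ← intervalIntegral.integral_of_le ha0.le,
      integral_rpow (Or.inl (by linarith)), Real.rpow_add_one ha0.ne', Real.rpow_mul ha0.le,
      Real.rpow_natCast, Real.zero_rpow (by positivity)]
    field_simp
    ring
  have hint : ∀ n : ℕ, IntegrableOn (fun s : ℝ ↦ (s ^ r) ^ n) (Set.Ioc 0 a) := fun n ↦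
    (((Real.continuous_rpow_const hr.le).pow n).integrableOn_Icc).mono_set Set.Ioc_subset_Icc_self
  have hsum := hasSum_integral_of_summable_integral_norm (μ := volume.restrict (Set.Ioc 0 a))
    (F := fun (n : ℕ) (s : ℝ) ↦ (s ^ r) ^ n) hint (by
      have h : ∀ n : ℕ, ∫ s in Set.Ioc 0 a, ‖(s ^ r) ^ n‖
          = (1 / r) / (1 / r + n) * (a ^ r) ^ n * a := fun n ↦ by
        rw [← key n]
        refine setIntegral_congr_fun measurableSet_Ioc fun s hs ↦ ?_
        exact Real.norm_of_nonneg (pow_nonneg (Real.rpow_nonneg hs.1.le r) n)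
      simp_rw [h]
      refine Summable.mul_right a ?_
      refine Summable.of_nonneg_of_le (fun n ↦ by positivity) (fun n ↦ ?_)
        (summable_geometric_of_lt_one har0.le har1)
      refine mul_le_of_le_one_left (by positivity) ?_
      rw [div_le_one (by positivity)]
      simp)
  simp_rw [key] at hsum
  have htsum : ∫ s in Set.Ioc 0 a, (∑' n : ℕ, (s ^ r) ^ n) = ∫ s in (0:ℝ)..a, (1 - s ^ r)⁻¹ := by
    rw [intervalIntegral.integral_of_le ha0.le]
    refine setIntegral_congr_fun measurableSet_Ioc fun s hs ↦ ?_
    exact tsum_geometric_of_lt_one (Real.rpow_nonneg hs.1.le r)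
      (Real.rpow_lt_one hs.1.le (hs.2.trans_lt ha1) hr)
  rw [htsum] at hsum
  simpa [ha0.ne'] using hsum.div_const a

lemma hasSum_integral_beta_mul_one_sub_rpow {e x : ℝ} (he0 : 0 < e) (he1 : e ≤ 1)
    (hx0 : 0 < x) (hx1 : x < 1) :
    HasSum (fun n : ℕ ↦ Ring.multichoose e n * BetaFn (e + n) e * x ^ n)
      (∫ u in Set.Ioc (0:ℝ) 1, u ^ (e - 1) * (1 - u) ^ (e - 1) * (1 - x * u) ^ (-e)) := by
  have hint : ∀ n : ℕ, IntegrableOn (fun u : ℝ ↦ Ring.multichoose e n * x ^ n *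
      (u ^ (e + n - 1) * (1 - u) ^ (e - 1))) (Set.Ioc 0 1) := fun n ↦
    (integrableOn_beta (by positivity) he0).const_mul _
  have key : ∀ n : ℕ, ∫ u in Set.Ioc (0:ℝ) 1, Ring.multichoose e n * x ^ n *
      (u ^ (e + n - 1) * (1 - u) ^ (e - 1)) = Ring.multichoose e n * BetaFn (e + n) e * x ^ n := by
    intro n
    rw [MeasureTheory.integral_const_mul, BetaFn, intervalIntegral.integral_of_le zero_le_one]
    ring
  have hsum := hasSum_integral_of_summable_integral_norm hint (by
      have h : ∀ n : ℕ, ∫ u in Set.Ioc (0:ℝ) 1, ‖Ring.multichoose e n * x ^ n *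
          (u ^ (e + n - 1) * (1 - u) ^ (e - 1))‖
            = Ring.multichoose e n * BetaFn (e + n) e * x ^ n := fun n ↦ by
        rw [← key n]
        refine setIntegral_congr_fun measurableSet_Ioc fun u hu ↦ ?_
        refine Real.norm_of_nonneg ?_
        have := multichoose_nonneg he0.le n
        have := Real.rpow_nonneg hu.1.le (e + n - 1)
        have := Real.rpow_nonneg (sub_nonneg.2 hu.2) (e - 1)
        positivity
      simp_rw [h]
      refine Summable.of_nonneg_of_le (fun n ↦ ?_) (fun n ↦ ?_)
        ((summable_geometric_of_lt_one hx0.le hx1).mul_left (BetaFn e e))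
      · have := multichoose_nonneg he0.le n
        have := betaFn_pos (show 0 < e + n by positivity) he0
        positivity
      · have hB := betaFn_pos he0 he0
        gcongr
        refine (multichoose_mul_betaFn_le he0 he1 n).trans
          (mul_le_of_le_one_right hB.le ?_)
        rw [div_le_one (by positivity)]
        simp)
  simp_rw [key] at hsum
  refine (congrArg (HasSum _) ?_).mpr hsum
  refine setIntegral_congr_fun measurableSet_Ioc fun u hu ↦ ?_
  have hxu0 : 0 < x * u := mul_pos hx0 hu.1
  have hxu1 : x * u < 1 := (mul_le_of_le_one_right hx0.le hu.2).trans_lt hx1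
  have h := ((one_sub_rpow_neg_hasSum e (x := x * u)
    (by rwa [abs_of_pos hxu0])).mul_left (u ^ (e - 1) * (1 - u) ^ (e - 1)))
  refine h.tsum_eq.symm.trans (tsum_congr fun n ↦ ?_)
  rw [show e + n - 1 = e - 1 + n by ring, Real.rpow_add hu.1, Real.rpow_natCast, mul_pow]
  ring

lemma integrableOn_beta_mul_one_sub_rpow {e x : ℝ} (he0 : 0 < e) (hx0 : 0 < x) (hx1 : x < 1) :
    IntegrableOn (fun u : ℝ ↦ u ^ (e - 1) * (1 - u) ^ (e - 1) * (1 - x * u) ^ (-e))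
      (Set.Ioc 0 1) := by
  have h : IntervalIntegrable (fun u : ℝ ↦ u ^ (e - 1) * (1 - u) ^ (e - 1)) volume 0 1 :=
    (intervalIntegrable_iff_integrableOn_Ioc_of_le zero_le_one).2 (integrableOn_beta he0 he0)
  rw [← intervalIntegrable_iff_integrableOn_Ioc_of_le zero_le_one]
  refine h.mul_continuousOn ?_
  refine ContinuousOn.rpow_const (by fun_prop) fun u hu ↦ Or.inl ?_
  rw [Set.uIcc_of_le zero_le_one] at hu
  nlinarith [hu.1, hu.2]

/-- The substitution `u = t ^ q`. -/
lemma Kpq_eq_integral (p k : ℝ) {q : ℝ} (hq : 0 < q) :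
    Kpq p q k = (1 / q) * ∫ u in Set.Ioo (0:ℝ) 1, u ^ (1 / q - 1) *
      ((1 - u) ^ (-(1 / p)) * (1 - k ^ q * u) ^ (-(1 / (p / (p - 1))))) := by
  set f : ℝ → ℝ := fun t ↦
    (1 - t ^ q) ^ (-(1 / p)) * (1 - k ^ q * t ^ q) ^ (-(1 / (p / (p - 1)))) with hf
  have h := integral_comp_rpow_Ioi_of_pos (g := (Set.Ioo (0:ℝ) 1).indicator f)
    (p := 1 / q) (by positivity)
  rw [MeasureTheory.integral_indicator measurableSet_Ioo, Measure.restrict_restrict measurableSet_Ioo,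
    Set.inter_eq_left.2 Set.Ioo_subset_Ioi_self] at h
  rw [Kpq, intervalIntegral.integral_of_le zero_le_one, integral_Ioc_eq_integral_Ioo, ← h,
    ← MeasureTheory.integral_const_mul, ← MeasureTheory.integral_indicator measurableSet_Ioo,
    ← MeasureTheory.integral_indicator measurableSet_Ioi]
  congr 1
  ext u
  by_cases hu : 0 < u
  · have hq' : 0 < 1 / q := by positivity
    have hpow : (u ^ (1 / q)) ^ q = u := by
      rw [← Real.rpow_mul hu.le, one_div_mul_cancel hq.ne', Real.rpow_one]
    rw [Set.indicator_of_mem (s := Set.Ioi 0) hu]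
    by_cases hu1 : u < 1
    · rw [Set.indicator_of_mem (s := Set.Ioo 0 1) ⟨hu, hu1⟩, Set.indicator_of_mem
        (s := Set.Ioo 0 1) ⟨Real.rpow_pos_of_pos hu _, Real.rpow_lt_one hu.le hu1 hq'⟩]
      simp only [hf, hpow, smul_eq_mul]
      ring
    · rw [Set.indicator_of_notMem (s := Set.Ioo 0 1) fun h ↦ hu1 h.2, Set.indicator_of_notMem
        (s := Set.Ioo 0 1) fun h ↦ h.2.not_ge (Real.one_le_rpow (not_lt.1 hu1) hq'.le), smul_zero]
  · rw [Set.indicator_of_notMem (s := Set.Ioi 0) hu,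
      Set.indicator_of_notMem (s := Set.Ioo 0 1) fun h ↦ hu h.1]

lemma Kpq_le_integral {p q k e : ℝ} (hp : 1 < p) (hq : 0 < q) (hk0 : 0 < k) (hk1 : k < 1)
    (he0 : 0 < e) (he : e ≤ 1 / (p / (p - 1))) (heq : e ≤ 1 / q) :
    Kpq p q k ≤ (1 / q) * ∫ u in Set.Ioc (0:ℝ) 1,
      u ^ (e - 1) * (1 - u) ^ (e - 1) * (1 - k ^ q * u) ^ (-e) := by
  have hx0 : 0 < k ^ q := Real.rpow_pos_of_pos hk0 q
  have hx1 : k ^ q < 1 := Real.rpow_lt_one hk0.le hk1 hq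
  set c := 1 / (p / (p - 1)) with hc
  have hpc : -(1 / p) = c - 1 := by
    have : p ≠ 0 := by positivity
    have : p - 1 ≠ 0 := by linarith
    rw [hc]; field_simp; ring
  rw [Kpq_eq_integral p k hq, integral_Ioc_eq_integral_Ioo]
  refine mul_le_mul_of_nonneg_left ?_ (by positivity)
  refine integral_mono_of_nonneg ?_
    ((integrableOn_beta_mul_one_sub_rpow he0 hx0 hx1).mono_set Set.Ioo_subset_Ioc_self) ?_
  all_goals
    refine (ae_restrict_mem measurableSet_Ioo).mono fun u hu ↦ ?_
    have h1 : 0 < 1 - u := by linarith [hu.2]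
    have h2 : 1 - u ≤ 1 - k ^ q * u := by nlinarith [hu.1]
    have h3 : 0 < 1 - k ^ q * u := h1.trans_le h2
  · have := hu.1
    simp only [Pi.zero_apply]
    positivity
  · simp only [← hc, hpc]
    rw [mul_assoc]
    have h4 : (1 - u) ^ (c - 1) * (1 - k ^ q * u) ^ (-c)
        ≤ (1 - u) ^ (e - 1) * (1 - k ^ q * u) ^ (-e) := by
      have h5 : (1 - u) ^ (c - e) ≤ (1 - k ^ q * u) ^ (c - e) :=
        Real.rpow_le_rpow h1.le h2 (by linarith)
      calc _ = (1 - u) ^ (e - 1) * (1 - u) ^ (c - e) * (1 - k ^ q * u) ^ (-c) := by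
            rw [← Real.rpow_add h1]; ring_nf
        _ ≤ (1 - u) ^ (e - 1) * (1 - k ^ q * u) ^ (c - e) * (1 - k ^ q * u) ^ (-c) := by gcongr
        _ = _ := by rw [mul_assoc, ← Real.rpow_add h3]; ring_nf
    have h6 : u ^ (1 / q - 1) ≤ u ^ (e - 1) :=
      Real.rpow_le_rpow_of_exponent_ge hu.1 hu.2.le (by linarith)
    have := hu.1
    exact mul_le_mul h6 h4 (by positivity) (by positivity)

theorem stmt0 (p q k : ℝ) (hp : 1 < p) (hq : 1 < q) (hk0 : 0 < k) (hk1 : k < 1)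
    (r : ℝ) (hr : r = max (p / (p - 1)) q)
    (hB : (1 / q) * BetaFn (1 / r) (1 / r) < 8 / (π ^ 2 - 8))
    (hK : (∫ s in (0:ℝ)..(k ^ (q / r)), (1 - s ^ r)⁻¹) / k ^ (q / r)
        ≤ (8 * q / (π ^ 2 - 8)) * (BetaFn (1 / r) (1 / r))⁻¹) :
    Kpq p q k < 8 / (π ^ 2 - 8) := by
  have hq0 : 0 < q := by linarith
  have hqr : q ≤ r := hr ▸ le_max_right _ _
  have hpr : p / (p - 1) ≤ r := hr ▸ le_max_left _ _
  have hr1 : 1 < r := hq.trans_le hqr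
  have hr0 : 0 < r := by linarith
  have he0 : 0 < 1 / r := by positivity
  have he1 : 1 / r < 1 := (div_lt_one hr0).2 hr1
  have hp' : 0 < p / (p - 1) := div_pos (by linarith) (by linarith)
  have hx0 : 0 < k ^ q := Real.rpow_pos_of_pos hk0 q
  have hx1 : k ^ q < 1 := Real.rpow_lt_one hk0.le hk1 hq0
  have hBpos := betaFn_pos he0 he0
  have hM := (hasSum_integral_inv_one_sub_rpow hr0 (Real.rpow_pos_of_pos hk0 (q / r))
    (Real.rpow_lt_one hk0.le hk1 (by positivity))).mul_left (BetaFn (1 / r) (1 / r))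
  rw [← Real.rpow_mul hk0.le, div_mul_cancel₀ q hr0.ne'] at hM
  have hlt := hasSum_lt (i := 1) (fun n ↦ ?_) ?_
    (hasSum_integral_beta_mul_one_sub_rpow he0 he1.le hx0 hx1) hM
  · calc Kpq p q k ≤ _ := Kpq_le_integral hp hq0 hk0 hk1 he0
          (one_div_le_one_div_of_le hp' hpr) (one_div_le_one_div_of_le hq0 hqr)
      _ < (1 / q) * _ := mul_lt_mul_of_pos_left hlt (by positivity)
      _ ≤ (1 / q) * (BetaFn (1 / r) (1 / r) *
          ((8 * q / (π ^ 2 - 8)) * (BetaFn (1 / r) (1 / r))⁻¹)) := by gcongr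
      _ = 8 / (π ^ 2 - 8) := by
        field_simp
  · rw [← mul_assoc]
    exact mul_le_mul_of_nonneg_right (multichoose_mul_betaFn_le he0 he1.le n) (by positivity)
  · rw [← mul_assoc]
    refine mul_lt_mul_of_pos_right ?_ (by positivity)
    simpa using multichoose_one_mul_betaFn_lt he0 he1
end

section
/- Let p, q ∈ (1,∞) with p' = p/(p−1) ≤ q, and let k ∈ (0,1). If (∫₀^{k} (1 − s^q)^{−1} ds) / k ≤ (8q/(π² − 8))·B(1/q, 1/q)^{−1}, then K_{pq}(k) < 8/(π² − 8). -/
open Real intervalIntegral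

open Set MeasureTheory

/-- Strict Chebyshev correlation inequality: a strictly decreasing and a strictly increasing
function are negatively correlated. -/
lemma setIntegral_mul_mul_lt_of_strictAntiOn_of_strictMonoOn {f h w : ℝ → ℝ} {c : ℝ}
    (hc : c ∈ Ioc (0 : ℝ) 1) (hf : StrictAntiOn f (Ioc 0 1)) (hh : StrictMonoOn h (Ioc 0 1))
    (hw : ∀ t ∈ Ioo (0 : ℝ) 1, 0 < w t) (iw : IntegrableOn w (Ioo 0 1))
    (ifw : IntegrableOn (fun t => f t * w t) (Ioo 0 1))
    (ihw : IntegrableOn (fun t => w t * h t) (Ioo 0 1))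
    (ifhw : IntegrableOn (fun t => f t * w t * h t) (Ioo 0 1))
    (hmean : ∫ t in Ioo (0 : ℝ) 1, f t * w t = f c * ∫ t in Ioo (0 : ℝ) 1, w t) :
    ∫ t in Ioo (0 : ℝ) 1, f t * w t * h t < f c * ∫ t in Ioo (0 : ℝ) 1, w t * h t := by
  have hpt : ∀ t ∈ Ioo (0 : ℝ) 1, t ≠ c → 0 < (f c - f t) * (h t - h c) * w t := by
    intro t ht htc
    have ht' : t ∈ Ioc (0 : ℝ) 1 := ⟨ht.1, ht.2.le⟩
    refine mul_pos ?_ (hw t ht)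
    rcases lt_or_gt_of_ne htc with h1 | h1
    · exact mul_pos_of_neg_of_neg (sub_neg.2 (hf ht' hc h1)) (sub_neg.2 (hh ht' hc h1))
    · exact mul_pos (sub_pos.2 (hf hc ht' h1)) (sub_pos.2 (hh hc ht' h1))
  have hexp : (fun t => (f c - f t) * (h t - h c) * w t) = fun t =>
      (f c * (w t * h t) - f t * w t * h t) - (f c * h c * w t - h c * (f t * w t)) := by
    ext t; ring
  have i₁ : IntegrableOn (fun t => f c * (w t * h t) - f t * w t * h t) (Ioo 0 1) :=
    (ihw.const_mul _).sub ifhw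
  have i₂ : IntegrableOn (fun t => f c * h c * w t - h c * (f t * w t)) (Ioo 0 1) :=
    (iw.const_mul _).sub (ifw.const_mul _)
  have hpos : 0 < ∫ t in Ioo (0 : ℝ) 1, (f c - f t) * (h t - h c) * w t := by
    rw [setIntegral_pos_iff_support_of_nonneg_ae]
    · have hsub : Ioo (0 : ℝ) 1 \ {c} ⊆
          Function.support (fun t => (f c - f t) * (h t - h c) * w t) ∩ Ioo 0 1 :=
        fun t ht => ⟨(hpt t ht.1 ht.2).ne', ht.1⟩
      refine lt_of_lt_of_le ?_ (measure_mono hsub)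
      rw [measure_sdiff_null (measure_singleton c)]
      simp
    · rw [Filter.EventuallyLE, ae_restrict_iff' measurableSet_Ioo]
      refine Filter.Eventually.of_forall fun t ht => ?_
      rcases eq_or_ne t c with rfl | htc
      · simp
      · exact (hpt t ht htc).le
    · rw [hexp]
      exact i₁.sub i₂
  rw [hexp, integral_sub i₁ i₂, integral_sub (ihw.const_mul _) ifhw,
    integral_sub (iw.const_mul _) (ifw.const_mul _)] at hpos
  simp only [MeasureTheory.integral_const_mul] at hpos
  rw [hmean] at hpos
  linarith

lemma integrableOn_rpow_mul_one_sub_rpow {a b : ℝ} (ha : 0 < a) (hb : 0 < b) :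
    IntegrableOn (fun t : ℝ => t ^ (a - 1) * (1 - t) ^ (b - 1)) (Ioo 0 1) := by
  have h := Complex.betaIntegral_convergent (u := (a : ℂ)) (v := (b : ℂ)) (by simpa) (by simpa)
  rw [intervalIntegrable_iff_integrableOn_Ioo_of_le zero_le_one] at h
  refine IntegrableOn.congr_fun (Integrable.re h) (fun t ht => ?_) measurableSet_Ioo
  have h1 : (t : ℂ) ^ ((a : ℂ) - 1) * (1 - (t : ℂ)) ^ ((b : ℂ) - 1)
      = ((t ^ (a - 1) * (1 - t) ^ (b - 1) : ℝ) : ℂ) := by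
    rw [Complex.ofReal_mul, Complex.ofReal_cpow ht.1.le,
      Complex.ofReal_cpow (sub_nonneg.2 ht.2.le)]
    push_cast
    rfl
  simp only [h1]
  exact Complex.ofReal_re _

lemma setIntegral_one_sub_rpow {b : ℝ} (hb : 0 < b) :
    ∫ t in Ioo (0 : ℝ) 1, (1 - t) ^ (b - 1) = 1 / b := by
  rw [← integral_Ioc_eq_integral_Ioo, ← integral_of_le zero_le_one,
    integral_comp_sub_left (fun t => t ^ (b - 1)) 1, integral_rpow (Or.inl (by linarith))]
  simp [hb.ne']

lemma integral_comp_rpow_eq_setIntegral {q : ℝ} (hq : 0 < q) (g : ℝ → ℝ) :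
    ∫ t in (0 : ℝ)..1, g (t ^ q)
      = 1 / q * ∫ u in Ioo (0 : ℝ) 1, u ^ (1 / q - 1) * g u := by
  have himg : (fun u : ℝ => u ^ (1 / q)) '' Ioo 0 1 = Ioo 0 1 := by
    ext t
    constructor
    · rintro ⟨u, hu, rfl⟩
      exact ⟨rpow_pos_of_pos hu.1 _, rpow_lt_one hu.1.le hu.2 (by positivity)⟩
    · intro ht
      refine ⟨t ^ q, ⟨rpow_pos_of_pos ht.1 _, rpow_lt_one ht.1.le ht.2 hq⟩, ?_⟩
      simp only
      rw [← rpow_mul ht.1.le, mul_one_div_cancel hq.ne', rpow_one]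
  have hinj : InjOn (fun u : ℝ => u ^ (1 / q)) (Ioo 0 1) := by
    intro u hu v hv huv
    exact (rpow_left_inj hu.1.le hv.1.le (by positivity)).1 huv
  have key := integral_image_eq_integral_abs_deriv_smul (s := Ioo (0 : ℝ) 1) measurableSet_Ioo
    (fun u hu => (hasDerivAt_rpow_const (p := 1 / q) (Or.inl hu.1.ne')).hasDerivWithinAt) hinj
    (fun t => g (t ^ q))
  rw [himg] at key
  rw [integral_of_le zero_le_one, integral_Ioc_eq_integral_Ioo, key, ← MeasureTheory.integral_const_mul]
  refine setIntegral_congr_fun measurableSet_Ioo fun u hu => ?_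
  have hu' := rpow_pos_of_pos hu.1 (1 / q - 1)
  simp only [smul_eq_mul]
  rw [abs_of_pos (by positivity), ← rpow_mul hu.1.le, one_div_mul_cancel hq.ne', rpow_one]
  ring

/-- Symmetry of the Euler integral for `₂F₁(a, b; a + b; x)` in `a` and `b`. -/
lemma setIntegral_euler_symm {a b x : ℝ} (hx0 : 0 ≤ x) (hx1 : x < 1) :
    ∫ u in Ioo (0 : ℝ) 1, u ^ (b - 1) * ((1 - u) ^ (a - 1) * (1 - x * u) ^ (-a))
      = ∫ t in Ioo (0 : ℝ) 1, t ^ (a - 1) * (1 - t) ^ (b - 1) * (1 - x * t) ^ (-b) := by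
  have hden : ∀ t ∈ Ioo (0 : ℝ) 1, 0 < 1 - x * t := fun t ht => by nlinarith [ht.1, ht.2]
  have hsub : ∀ t ∈ Ioo (0 : ℝ) 1, 1 - (1 - t) / (1 - x * t) = t * (1 - x) / (1 - x * t) := by
    intro t ht
    rw [eq_div_iff (hden t ht).ne', sub_mul, div_mul_cancel₀ _ (hden t ht).ne']
    ring
  have hsubx : ∀ t ∈ Ioo (0 : ℝ) 1, 1 - x * ((1 - t) / (1 - x * t)) = (1 - x) / (1 - x * t) := by
    intro t ht
    rw [eq_div_iff (hden t ht).ne', sub_mul, mul_assoc, div_mul_cancel₀ _ (hden t ht).ne']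
    ring
  have hmap : ∀ t ∈ Ioo (0 : ℝ) 1, (1 - t) / (1 - x * t) ∈ Ioo (0 : ℝ) 1 := by
    intro t ht
    have h1 := hden t ht
    have h2 := sub_pos.2 ht.2
    refine ⟨by positivity, ?_⟩
    have h3 : 0 < t * (1 - x) / (1 - x * t) := div_pos (mul_pos ht.1 (by linarith)) h1
    linarith [hsub t ht]
  have hinv : ∀ t ∈ Ioo (0 : ℝ) 1,
      (1 - (1 - t) / (1 - x * t)) / (1 - x * ((1 - t) / (1 - x * t))) = t := by
    intro t ht
    rw [hsub t ht, hsubx t ht]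
    have h1 := (hden t ht).ne'
    rw [mul_comm] at h1
    have h2 : 1 - x ≠ 0 := by linarith
    field_simp
  have himg : (fun t : ℝ => (1 - t) / (1 - x * t)) '' Ioo 0 1 = Ioo 0 1 := by
    ext t
    constructor
    · rintro ⟨u, hu, rfl⟩
      exact hmap u hu
    · exact fun ht => ⟨_, hmap t ht, hinv t ht⟩
  have hinj : InjOn (fun t : ℝ => (1 - t) / (1 - x * t)) (Ioo 0 1) := by
    intro u hu v hv huv
    simp only at huv
    rw [← hinv u hu, huv, hinv v hv]
  have hder : ∀ t ∈ Ioo (0 : ℝ) 1, HasDerivWithinAt (fun t : ℝ => (1 - t) / (1 - x * t))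
      (-(1 - x) / (1 - x * t) ^ 2) (Ioo 0 1) t := by
    intro t ht
    have h1 : HasDerivAt (fun t : ℝ => 1 - t) (-1) t := by
      simpa using (hasDerivAt_id t).const_sub 1
    have h2 : HasDerivAt (fun t : ℝ => 1 - x * t) (-x) t := by
      simpa using ((hasDerivAt_id t).const_mul x).const_sub 1
    have h3 := (h1.fun_div h2 (hden t ht).ne').hasDerivWithinAt (s := Ioo 0 1)
    rwa [show -1 * (1 - x * t) - (1 - t) * -x = -(1 - x) by ring] at h3
  have key := integral_image_eq_integral_abs_deriv_smul measurableSet_Ioo hder hinj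
    (fun u => u ^ (b - 1) * ((1 - u) ^ (a - 1) * (1 - x * u) ^ (-a)))
  rw [himg] at key
  rw [key]
  refine setIntegral_congr_fun measurableSet_Ioo fun t ht => ?_
  have h1 := hden t ht
  have h2 := sub_pos.2 ht.2
  have h3 := sub_pos.2 hx1
  have h4 := ht.1
  simp only [smul_eq_mul]
  rw [hsub t ht, hsubx t ht, neg_div, abs_neg, abs_of_pos (by positivity),
    div_rpow h2.le h1.le, div_rpow (by positivity) h1.le, mul_rpow h4.le h3.le,
    div_rpow h3.le h1.le, rpow_sub_one h3.ne', rpow_sub_one h1.ne', rpow_sub_one h1.ne',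
    rpow_neg h3.le, rpow_neg h1.le, rpow_neg h1.le]
  have h5 := (rpow_pos_of_pos h1 a).ne'
  have h6 := (rpow_pos_of_pos h1 b).ne'
  have h7 := (rpow_pos_of_pos h3 a).ne'
  have h8 := h1.ne'
  have h9 := h3.ne'
  field_simp

lemma setIntegral_beta_mul_rpow_lt {a b x : ℝ} (ha0 : 0 < a) (ha1 : a < 1) (hb : 0 < b)
    (hx0 : 0 < x) (hx1 : x < 1) :
    ∫ t in Ioo (0 : ℝ) 1, t ^ (a - 1) * (1 - t) ^ (b - 1) * (1 - x * t) ^ (-b)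
      < (b * ∫ t in Ioo (0 : ℝ) 1, t ^ (a - 1) * (1 - t) ^ (b - 1))
        * ∫ t in Ioo (0 : ℝ) 1, (1 - t) ^ (b - 1) * (1 - x * t) ^ (-b) := by
  set B := ∫ t in Ioo (0 : ℝ) 1, t ^ (a - 1) * (1 - t) ^ (b - 1) with hB
  have ifw := integrableOn_rpow_mul_one_sub_rpow ha0 hb
  have iw : IntegrableOn (fun t : ℝ => (1 - t) ^ (b - 1)) (Ioo 0 1) := by
    simpa using integrableOn_rpow_mul_one_sub_rpow one_pos hb
  have hm : 1 ≤ b * B := by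
    have : 1 / b ≤ B := by
      rw [← setIntegral_one_sub_rpow hb]
      refine setIntegral_mono_on iw ifw measurableSet_Ioo fun t ht => ?_
      exact le_mul_of_one_le_left (rpow_nonneg (sub_nonneg.2 ht.2.le) _)
        (one_le_rpow_of_pos_of_le_one_of_nonpos ht.1 ht.2.le (by linarith))
    rwa [div_le_iff₀' hb] at this
  have hm0 : 0 < b * B := by linarith
  have hfc : ((b * B) ^ (1 / (a - 1))) ^ (a - 1) = b * B := by
    rw [← rpow_mul hm0.le, one_div_mul_cancel (by linarith), rpow_one]
  have hc : (b * B) ^ (1 / (a - 1)) ∈ Ioc (0 : ℝ) 1 :=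
    ⟨rpow_pos_of_pos hm0 _, rpow_le_one_of_one_le_of_nonpos hm
      (one_div_nonpos.2 (by linarith))⟩
  have hden : ∀ t ∈ Ioc (0 : ℝ) 1, 1 - x ≤ 1 - x * t := fun t ht => by nlinarith [ht.1, ht.2]
  have hmeas : AEStronglyMeasurable (fun t : ℝ => (1 - x * t) ^ (-b))
      (volume.restrict (Ioo 0 1)) := by
    have : Measurable (fun t : ℝ => (1 - x * t) ^ (-b)) := by fun_prop
    exact this.aestronglyMeasurable
  have hbdd : ∀ᵐ t ∂(volume.restrict (Ioo (0 : ℝ) 1)),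
      ‖(1 - x * t) ^ (-b)‖ ≤ (1 - x) ^ (-b) := by
    rw [ae_restrict_iff' measurableSet_Ioo]
    refine Filter.Eventually.of_forall fun t ht => ?_
    have h1 := hden t ⟨ht.1, ht.2.le⟩
    rw [norm_of_nonneg (rpow_nonneg (by linarith) _)]
    exact rpow_le_rpow_of_nonpos (by linarith) h1 (by linarith)
  have key := setIntegral_mul_mul_lt_of_strictAntiOn_of_strictMonoOn
    (f := fun t => t ^ (a - 1)) (w := fun t => (1 - t) ^ (b - 1))
    (h := fun t => (1 - x * t) ^ (-b)) hc
    (fun s hs t _ hst => rpow_lt_rpow_of_neg hs.1 hst (by linarith))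
    (fun s _ t ht hst => rpow_lt_rpow_of_neg (by linarith [hden t ht]) (by nlinarith)
      (by linarith))
    (fun t ht => rpow_pos_of_pos (sub_pos.2 ht.2) _) iw ifw
    (Integrable.mul_bdd iw hmeas hbdd) (Integrable.mul_bdd ifw hmeas hbdd)
    (by
      simp only [hfc, setIntegral_one_sub_rpow hb]
      rw [← hB]
      field_simp)
  simpa only [hfc] using key

lemma BetaFn_eq_setIntegral (x y : ℝ) :
    BetaFn x y = ∫ t in Ioo (0 : ℝ) 1, t ^ (x - 1) * (1 - t) ^ (y - 1) := by
  rw [BetaFn, integral_of_le zero_le_one, integral_Ioc_eq_integral_Ioo]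

lemma BetaFn_pos {x y : ℝ} (hx : 0 < x) (hy : 0 < y) : 0 < BetaFn x y := by
  refine intervalIntegral_pos_of_pos_on ?_ (fun t ht => ?_) one_pos
  · rw [intervalIntegrable_iff_integrableOn_Ioo_of_le zero_le_one]
    exact integrableOn_rpow_mul_one_sub_rpow hx hy
  · exact mul_pos (rpow_pos_of_pos ht.1 _) (rpow_pos_of_pos (sub_pos.2 ht.2) _)

lemma BetaFn_anti_left {a b y : ℝ} (hb : 0 < b) (hba : b ≤ a) (hy : 0 < y) :
    BetaFn a y ≤ BetaFn b y := by
  rw [BetaFn_eq_setIntegral, BetaFn_eq_setIntegral]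
  refine setIntegral_mono_on (integrableOn_rpow_mul_one_sub_rpow (hb.trans_le hba) hy)
    (integrableOn_rpow_mul_one_sub_rpow hb hy) measurableSet_Ioo fun t ht => ?_
  exact mul_le_mul_of_nonneg_right (rpow_le_rpow_of_exponent_ge ht.1 ht.2.le (by linarith))
    (rpow_nonneg (sub_nonneg.2 ht.2.le) _)

lemma Kpq_eq_setIntegral {p q k : ℝ} (hp : 1 < p) (hq : 0 < q) (hk0 : 0 < k) (hk1 : k < 1) :
    Kpq p q k = 1 / q * ∫ t in Ioo (0 : ℝ) 1,
      t ^ ((1 - 1 / p) - 1) * (1 - t) ^ (1 / q - 1) * (1 - k ^ q * t) ^ (-(1 / q)) := by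
  have hp0 : p ≠ 0 := by linarith
  have ha : 1 / (p / (p - 1)) = 1 - 1 / p := by field_simp
  have h := integral_comp_rpow_eq_setIntegral hq
    (fun u => (1 - u) ^ (-(1 / p)) * (1 - k ^ q * u) ^ (-(1 / (p / (p - 1)))))
  rw [Kpq, h, ← setIntegral_euler_symm (rpow_nonneg hk0.le q) (rpow_lt_one hk0.le hk1 hq), ha,
    show (1 - 1 / p) - 1 = -(1 / p) by ring]

lemma integral_inv_one_sub_rpow_div {q k : ℝ} (hq : 0 < q) (hk0 : 0 < k) (hk1 : k < 1) :
    (∫ s in (0 : ℝ)..k, (1 - s ^ q)⁻¹) / k = 1 / q * ∫ t in Ioo (0 : ℝ) 1,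
      (1 - t) ^ (1 / q - 1) * (1 - k ^ q * t) ^ (-(1 / q)) := by
  have h1 : (∫ s in (0 : ℝ)..k, (1 - s ^ q)⁻¹) / k
      = ∫ t in (0 : ℝ)..1, (1 - k ^ q * t ^ q)⁻¹ := by
    have h := integral_comp_mul_left (a := 0) (b := 1) (fun s => (1 - s ^ q)⁻¹) hk0.ne'
    rw [mul_zero, mul_one, smul_eq_mul] at h
    rw [div_eq_inv_mul, ← h]
    refine integral_congr fun t ht => ?_
    rw [uIcc_of_le zero_le_one] at ht
    simp only [mul_rpow hk0.le ht.1]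
  have h2 := setIntegral_euler_symm (a := 1) (b := 1 / q) (rpow_nonneg hk0.le q)
    (rpow_lt_one hk0.le hk1 hq)
  simp only [sub_self, rpow_zero, one_mul, rpow_neg_one] at h2
  rw [h1, integral_comp_rpow_eq_setIntegral hq (fun u => (1 - k ^ q * u)⁻¹), h2]

theorem stmt1 (p q k : ℝ) (hp : 1 < p) (hq : 1 < q) (hpq : p / (p - 1) ≤ q)
    (hk0 : 0 < k) (hk1 : k < 1)
    (hK : (∫ s in (0:ℝ)..k, (1 - s ^ q)⁻¹) / k
        ≤ (8 * q / (π ^ 2 - 8)) * (BetaFn (1 / q) (1 / q))⁻¹) :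
    Kpq p q k < 8 / (π ^ 2 - 8) := by
  have hq0 : 0 < q := by linarith
  have hb : 0 < 1 / q := by positivity
  have hp0 : 0 < p := by linarith
  have ha1 : 1 - 1 / p < 1 := sub_lt_self _ (by positivity)
  have hba : 1 / q ≤ 1 - 1 / p := by
    have h := one_div_le_one_div_of_le (div_pos hp0 (sub_pos.2 hp)) hpq
    rwa [one_div_div, sub_div, div_self hp0.ne'] at h
  have hlt := setIntegral_beta_mul_rpow_lt (hb.trans_le hba) ha1 hb (rpow_pos_of_pos hk0 q)
    (rpow_lt_one hk0.le hk1 hq0)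
  rw [← BetaFn_eq_setIntegral] at hlt
  have hB := BetaFn_pos hb hb
  have hA : 0 ≤ (∫ s in (0 : ℝ)..k, (1 - s ^ q)⁻¹) / k := by
    refine div_nonneg (integral_nonneg hk0.le fun s hs => ?_) hk0.le
    exact inv_nonneg.2 (sub_nonneg.2 (rpow_le_one hs.1 (hs.2.trans hk1.le) hq0.le))
  calc Kpq p q k
      < 1 / q * ((1 / q * BetaFn (1 - 1 / p) (1 / q)) * ∫ t in Ioo (0 : ℝ) 1,
          (1 - t) ^ (1 / q - 1) * (1 - k ^ q * t) ^ (-(1 / q))) := by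
        rw [Kpq_eq_setIntegral hp hq0 hk0 hk1]
        exact mul_lt_mul_of_pos_left hlt hb
    _ = 1 / q * BetaFn (1 - 1 / p) (1 / q) * ((∫ s in (0 : ℝ)..k, (1 - s ^ q)⁻¹) / k) := by
        rw [integral_inv_one_sub_rpow_div hq0 hk0 hk1]
        ring
    _ ≤ 1 / q * BetaFn (1 / q) (1 / q) * ((∫ s in (0 : ℝ)..k, (1 - s ^ q)⁻¹) / k) := by
        gcongr
        exact BetaFn_anti_left hb hba hb
    _ ≤ 1 / q * BetaFn (1 / q) (1 / q)
          * ((8 * q / (π ^ 2 - 8)) * (BetaFn (1 / q) (1 / q))⁻¹) := by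
        gcongr
    _ = 8 / (π ^ 2 - 8) := by
        field_simp
end

section
/- For every real k with 0 ≤ k ≤ 0.99, the complete elliptic integral of the first kind K(k) = ∫₀¹ dt / ((1−t²)^{1/2}·(1−k²t²)^{1/2}) satisfies K(k) < 8/(π² − 8). -/
open Real intervalIntegral

/-- The complete elliptic integral of the first kind. -/
noncomputable def ellipticK (k : ℝ) : ℝ :=
  ∫ t in (0:ℝ)..1, 1 / (Real.sqrt (1 - t ^ 2) * Real.sqrt (1 - k ^ 2 * t ^ 2))

/-- Derivative of the antiderivative of `1 / (√(1 - t²) (1 - (1 - q²) t²))`, up to the factor `q`. -/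
lemma hasDerivAt_arcsin_div_sqrt {q t : ℝ} (ht0 : 0 < t) (ht1 : t < 1) :
    HasDerivAt (fun x : ℝ => arcsin (q * x / √(1 - (1 - q ^ 2) * x ^ 2)))
      (q / (√(1 - t ^ 2) * √(1 - (1 - q ^ 2) * t ^ 2) ^ 2)) t := by
  have hr : 0 < 1 - t ^ 2 := by nlinarith
  have hs : 0 < 1 - (1 - q ^ 2) * t ^ 2 := by nlinarith [sq_nonneg (q * t)]
  have hspos := Real.sqrt_pos.mpr hs
  have hrpos := Real.sqrt_pos.mpr hr
  have hssq := Real.sq_sqrt hs.le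
  have h1 : HasDerivAt (fun x : ℝ => 1 - (1 - q ^ 2) * x ^ 2) (-((1 - q ^ 2) * (2 * t))) t := by
    simpa using ((hasDerivAt_pow 2 t).const_mul (1 - q ^ 2)).const_sub 1
  have h3 := (((hasDerivAt_id t).const_mul q).div (h1.sqrt hs.ne') hspos.ne')
  simp only [id] at h3
  have hu : 1 - (q * t / √(1 - (1 - q ^ 2) * t ^ 2)) ^ 2
      = (1 - t ^ 2) / √(1 - (1 - q ^ 2) * t ^ 2) ^ 2 := by
    rw [div_pow, eq_div_iff (by positivity), sub_mul, div_mul_cancel₀ _ (by positivity), hssq]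
    ring
  have hlt : 0 < 1 - (q * t / √(1 - (1 - q ^ 2) * t ^ 2)) ^ 2 := by
    rw [hu]; positivity
  have hsq : √(1 - (q * t / √(1 - (1 - q ^ 2) * t ^ 2)) ^ 2)
      = √(1 - t ^ 2) / √(1 - (1 - q ^ 2) * t ^ 2) := by
    rw [hu, Real.sqrt_div hr.le, Real.sqrt_sq hspos.le]
  have h4 := (Real.hasDerivAt_arcsin (x := q * t / √(1 - (1 - q ^ 2) * t ^ 2))
    (by intro h; rw [h] at hlt; norm_num at hlt)
    (by intro h; rw [h] at hlt; norm_num at hlt)).comp t h3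
  refine h4.congr_deriv ?_
  rw [hsq]
  generalize √(1 - (1 - q ^ 2) * t ^ 2) = s at *
  field_simp
  rw [hssq]; ring

/-- The AM-GM bound for `ellipticK`, where `q` bounds the complementary modulus from below. -/
lemma ellipticK_le {k q l : ℝ} (hq : 0 < q) (hl : 0 < l) (hkq : k ^ 2 ≤ 1 - q ^ 2) :
    ellipticK k ≤ π / 4 * (l + 1 / (l * q)) := by
  unfold ellipticK
  by_cases hint : IntervalIntegrable
      (fun t : ℝ => 1 / (√(1 - t ^ 2) * √(1 - k ^ 2 * t ^ 2))) MeasureTheory.volume 0 1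
  swap
  · rw [intervalIntegral.integral_undef hint]; positivity
  have hpos : ∀ x ∈ Set.Icc (0:ℝ) 1, 0 < 1 - (1 - q ^ 2) * x ^ 2 := by
    rintro x ⟨h0, h1⟩
    have hx : x ^ 2 ≤ 1 := by nlinarith
    rcases h0.eq_or_lt with rfl | h0
    · norm_num
    · have : 0 < (q * x) ^ 2 := by positivity
      nlinarith
  have key := integral_le_sub_of_hasDeriv_right_of_le (a := 0) (b := 1)
    (g := fun x : ℝ => l / 2 * arcsin x
      + 1 / (2 * l * q) * arcsin (q * x / √(1 - (1 - q ^ 2) * x ^ 2)))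
    (g' := fun t => l / 2 * (1 / √(1 - t ^ 2))
      + 1 / (2 * l * q) * (q / (√(1 - t ^ 2) * √(1 - (1 - q ^ 2) * t ^ 2) ^ 2)))
    (φ := fun t => 1 / (√(1 - t ^ 2) * √(1 - k ^ 2 * t ^ 2))) zero_le_one ?_ ?_
    ((intervalIntegrable_iff_integrableOn_Icc_of_le zero_le_one).mp hint) ?_
  · refine key.trans (le_of_eq ?_)
    have : √(1 - (1 - q ^ 2) * 1 ^ 2) = q := by
      rw [show 1 - (1 - q ^ 2) * 1 ^ 2 = q ^ 2 by ring, Real.sqrt_sq hq.le]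
    simp only [this, mul_one, div_self hq.ne', arcsin_one, mul_zero, zero_div, arcsin_zero]
    field_simp
    ring
  · refine ContinuousOn.add (by fun_prop) (continuousOn_const.mul
      (Real.continuous_arcsin.comp_continuousOn (ContinuousOn.div (by fun_prop) (by fun_prop) ?_)))
    exact fun x hx => (Real.sqrt_pos.mpr (hpos x hx)).ne'
  · rintro x ⟨h0, h1⟩
    exact (((Real.hasDerivAt_arcsin (by linarith) h1.ne).const_mul _).add
      ((hasDerivAt_arcsin_div_sqrt h0 h1).const_mul _)).hasDerivWithinAt
  · rintro x ⟨h0, h1⟩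
    have hr : 0 < √(1 - x ^ 2) := Real.sqrt_pos.mpr (by nlinarith)
    have hs : 0 < √(1 - (1 - q ^ 2) * x ^ 2) := Real.sqrt_pos.mpr (hpos x ⟨h0.le, h1.le⟩)
    have hle : √(1 - (1 - q ^ 2) * x ^ 2) ≤ √(1 - k ^ 2 * x ^ 2) := by gcongr
    calc 1 / (√(1 - x ^ 2) * √(1 - k ^ 2 * x ^ 2))
        ≤ 1 / (√(1 - x ^ 2) * √(1 - (1 - q ^ 2) * x ^ 2)) := by gcongr
      _ ≤ _ := by
        generalize √(1 - (1 - q ^ 2) * x ^ 2) = s at *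
        rw [← sub_nonneg]
        have : l / 2 * (1 / √(1 - x ^ 2)) + 1 / (2 * l * q) * (q / (√(1 - x ^ 2) * s ^ 2))
            - 1 / (√(1 - x ^ 2) * s) = (l * s - 1) ^ 2 / (2 * l * √(1 - x ^ 2) * s ^ 2) := by
          field_simp
          ring
        rw [this]
        positivity

theorem stmt2 (k : ℝ) (hk0 : 0 ≤ k) (hk1 : k ≤ 0.99) :
    ellipticK k < 8 / (π ^ 2 - 8) := by
  have h := ellipticK_le (k := k) (q := 0.141) (l := 8 / 3) (by norm_num) (by norm_num)
    (by norm_num at hk1 ⊢; nlinarith)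
  refine h.trans_lt ?_
  have hp1 := Real.pi_gt_three
  have hp2 := Real.pi_lt_d4
  rw [lt_div_iff₀ (by nlinarith)]
  have h2 : π ^ 2 - 8 < 1.87 := by norm_num at hp2 ⊢; nlinarith
  have h3 : π / 4 * (8 / 3 + 1 / (8 / 3 * 0.141)) < 4.2 := by norm_num at hp2 ⊢; linarith
  nlinarith
end

section
/- Let p, q ∈ (1,∞), set p' = p/(p−1) and r = max{p', q}. If r/q < 4/(π² − 8) and 0 ≤ k < (1 − ((π² − 8)·r/(4q))^r)^{1/q}, then K_{pq}(k) < 8/(π² − 8). -/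
open Real intervalIntegral

/-- An upper bound from a primitive `G` of a majorant; no integrability of `f` is needed since the
bound is nonnegative. -/
lemma integral_le_of_le_deriv {f G G' : ℝ → ℝ} {C : ℝ} (hC : 0 ≤ C)
    (hG : ContinuousOn G (Set.Icc 0 1))
    (hG' : ∀ t ∈ Set.Ioo (0 : ℝ) 1, HasDerivAt G (G' t) t)
    (hf : ∀ t ∈ Set.Ioo (0 : ℝ) 1, f t ≤ G' t) (hGC : G 1 - G 0 ≤ C) :
    ∫ t in (0 : ℝ)..1, f t ≤ C := by
  by_cases hi : IntervalIntegrable f MeasureTheory.volume 0 1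
  · refine le_trans ?_ hGC
    exact integral_le_sub_of_hasDeriv_right_of_le zero_le_one hG
      (fun t ht => (hG' t ht).hasDerivWithinAt)
      ((intervalIntegrable_iff_integrableOn_Icc_of_le zero_le_one).1 hi) hf
  · rwa [intervalIntegral.integral_undef hi]

lemma integral_le_rpow_neg_mul {q b m : ℝ} (hq : 1 < q) (hb0 : 0 < b) (hm0 : 0 ≤ m)
    (hm1 : m < 1) :
    ∫ t in (0 : ℝ)..1, (1 - t ^ q) ^ (b - 1) * (1 - m * t ^ q) ^ (-b) ≤
      (1 - m) ^ (-b) * (1 + 1 / (q * b)) := by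
  have hq0 : 0 < q := by linarith
  have hx : 0 < 1 - m := by linarith
  have hX : 0 < (1 - m) ^ (-b) := rpow_pos_of_pos hx _
  refine integral_le_of_le_deriv
    (G := fun t => (1 - m) ^ (-b) * (t - 1 / (q * b) * (1 - t ^ q) ^ b))
    (G' := fun t => (1 - m) ^ (-b) * (1 + t ^ (q - 1) * (1 - t ^ q) ^ (b - 1)))
    (by positivity) ?_ ?_ ?_ ?_
  · have h1 : Continuous fun t : ℝ => t ^ q := continuous_id.rpow_const fun _ => Or.inr hq0.le
    have h2 : Continuous fun t : ℝ => (1 - t ^ q) ^ b :=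
      (continuous_const.sub h1).rpow_const fun _ => Or.inr hb0.le
    exact Continuous.continuousOn (by fun_prop)
  · rintro t ⟨ht0, ht1⟩
    have hT : t ^ q < 1 := rpow_lt_one ht0.le ht1 hq0
    have h1 : HasDerivAt (fun t : ℝ => t ^ q) (q * t ^ (q - 1)) t :=
      hasDerivAt_rpow_const (Or.inl ht0.ne')
    have h2 := (h1.const_sub 1).rpow_const (p := b) (Or.inl (by linarith))
    refine (((hasDerivAt_id t).sub (h2.const_mul (1 / (q * b)))).const_mul
      ((1 - m) ^ (-b))).congr_deriv ?_
    field_simp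
    ring
  · rintro t ⟨ht0, ht1⟩
    have hT : t ^ q < 1 := rpow_lt_one ht0.le ht1 hq0
    have hT0 : 0 < t ^ q := rpow_pos_of_pos ht0 q
    have hs : 0 < 1 - t ^ q := by linarith
    have hD : (1 - m * t ^ q) ^ (-b) ≤ (1 - m) ^ (-b) :=
      rpow_le_rpow_of_nonpos hx (by nlinarith) (by linarith)
    have hτ : t ^ q ≤ t ^ (q - 1) := rpow_le_rpow_of_exponent_ge ht0 ht1.le (by linarith)
    have hS : 0 < (1 - t ^ q) ^ (b - 1) := rpow_pos_of_pos hs _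
    have hsb : (1 - t ^ q) ^ (b - 1) * (1 - t ^ q) ≤ 1 := by
      rw [← rpow_add_one hs.ne']
      exact rpow_le_one hs.le (by linarith) (by linarith)
    have key : (1 - t ^ q) ^ (b - 1) ≤ 1 + t ^ (q - 1) * (1 - t ^ q) ^ (b - 1) := by
      nlinarith
    calc _ ≤ (1 - t ^ q) ^ (b - 1) * (1 - m) ^ (-b) := by gcongr
      _ ≤ _ := by rw [mul_comm]; gcongr
  · simp only [one_rpow, sub_self, zero_rpow hq0.ne', zero_rpow hb0.ne', sub_zero]
    apply le_of_eq
    ring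

lemma integral_le_rpow_neg_inv_mul {q b m : ℝ} (hq : 1 < q) (hb0 : 0 < b) (hm0 : 0 ≤ m)
    (hm1 : m < 1) :
    ∫ t in (0 : ℝ)..1, (1 - t ^ q) ^ (b - 1) * (1 - m * t ^ q) ^ (-b) ≤
      (1 - m) ^ (-(1 / q)) * (1 + 1 / (q * b)) := by
  have hq0 : 0 < q := by linarith
  have hx : 0 < 1 - m := by linarith
  have hX : 0 < (1 - m) ^ (-(1 / q)) := rpow_pos_of_pos hx _
  have hD0 : ∀ t ∈ Set.Icc (0 : ℝ) 1, 0 < 1 - m * t ^ q := fun t ht => by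
    have : t ^ q ≤ 1 := rpow_le_one ht.1 ht.2 hq0.le
    nlinarith
  refine integral_le_of_le_deriv
    (G := fun t => t * (1 - m * t ^ q) ^ (-(1 / q)) -
      1 / (q * b) * (1 - m) ^ (-(1 / q)) * ((1 - t ^ q) / (1 - m * t ^ q)) ^ b)
    (G' := fun t => (1 - m * t ^ q) ^ (-(1 / q) - 1) + (1 - m) ^ (-(1 / q)) * (1 - m) *
      t ^ (q - 1) * ((1 - t ^ q) / (1 - m * t ^ q)) ^ (b - 1) / (1 - m * t ^ q) ^ 2)
    (by positivity) ?_ ?_ ?_ ?_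
  · have h1 : Continuous fun t : ℝ => t ^ q := continuous_id.rpow_const fun _ => Or.inr hq0.le
    have h2 : Continuous fun t : ℝ => 1 - m * t ^ q := by fun_prop
    have h3 : ContinuousOn (fun t : ℝ => (1 - m * t ^ q) ^ (-(1 / q))) (Set.Icc 0 1) :=
      h2.continuousOn.rpow_const fun t ht => Or.inl (hD0 t ht).ne'
    have h4 : ContinuousOn (fun t : ℝ => ((1 - t ^ q) / (1 - m * t ^ q)) ^ b) (Set.Icc 0 1) :=
      ((continuous_const.sub h1).continuousOn.div h2.continuousOn
        fun t ht => (hD0 t ht).ne').rpow_const fun _ _ => Or.inr hb0.le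
    fun_prop
  · rintro t ⟨ht0, ht1⟩
    have hT : t ^ q < 1 := rpow_lt_one ht0.le ht1 hq0
    have hD := hD0 t ⟨ht0.le, ht1.le⟩
    have hs : 0 < 1 - t ^ q := by linarith
    have h1 : HasDerivAt (fun t : ℝ => t ^ q) (q * t ^ (q - 1)) t :=
      hasDerivAt_rpow_const (Or.inl ht0.ne')
    have h2 := (h1.const_mul m).const_sub 1
    have h3 := h2.rpow_const (p := -(1 / q)) (Or.inl hD.ne')
    have h4 := ((h1.const_sub 1).div h2 hD.ne').rpow_const (p := b)
      (Or.inl (div_pos hs hD).ne')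
    refine (((hasDerivAt_id t).mul h3).sub
      (h4.const_mul (1 / (q * b) * (1 - m) ^ (-(1 / q))))).congr_deriv ?_
    have e1 : (1 - m * t ^ q) ^ (-(1 / q)) =
        (1 - m * t ^ q) ^ (-(1 / q) - 1) * (1 - m * t ^ q) := by
      rw [← rpow_add_one hD.ne']; ring_nf
    have e2 : t ^ q = t ^ (q - 1) * t := by
      rw [← rpow_add_one ht0.ne']; ring_nf
    simp only [id, Pi.div_apply]
    rw [e1]
    generalize (1 - m * t ^ q) ^ (-(1 / q) - 1) = A
    generalize ((1 - t ^ q) / (1 - m * t ^ q)) ^ (b - 1) = B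
    generalize (1 - m) ^ (-(1 / q)) = X
    rw [e2] at hD ⊢
    generalize t ^ (q - 1) = τ at hD ⊢
    field_simp
    ring
  · rintro t ⟨ht0, ht1⟩
    have hT : t ^ q < 1 := rpow_lt_one ht0.le ht1 hq0
    have hT0 : 0 < t ^ q := rpow_pos_of_pos ht0 q
    have hs : 0 < 1 - t ^ q := by linarith
    have hD := hD0 t ⟨ht0.le, ht1.le⟩
    have hτ : t ^ (q - 1) = (t ^ q) ^ (1 - 1 / q) := by
      rw [← rpow_mul ht0.le]; congr 1; field_simp
    have eX : (1 - m) ^ (-(1 / q)) * (1 - m) = (1 - m) ^ (1 - 1 / q) := by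
      rw [← rpow_add_one hx.ne']; ring_nf
    have eD : (1 - m * t ^ q) ^ (-(1 / q) - 1) =
        (1 - m * t ^ q) ^ (-(1 / q)) / (1 - m * t ^ q) := rpow_sub_one hD.ne' _
    have hDa : 1 ≤ (1 - m * t ^ q) ^ (-(1 / q)) :=
      one_le_rpow_of_pos_of_le_one_of_nonpos hD (by nlinarith)
        (by rw [neg_nonpos]; positivity)
    rw [hτ, eX, eD]
    set T := t ^ q
    set D := 1 - m * T with hDdef
    set v := (1 - T) / D with hv
    have hv0 : 0 < v := div_pos hs hD
    have hv1 : v ≤ 1 := by rw [hv, div_le_one hD]; nlinarith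
    have hw : 1 - v = (1 - m) * T / D := by
      rw [hv]; field_simp; rw [hDdef]; ring
    have hw0 : 0 < (1 - m) * T / D := by positivity
    have eL : (1 - T) ^ (b - 1) * D ^ (-b) = v ^ (b - 1) / D := by
      rw [hv, div_rpow hs.le hD.le, rpow_sub_one hD.ne', rpow_neg hD.le]
      field_simp
    have hvb : v ^ (b - 1) * v ≤ 1 := by
      rw [← rpow_add_one hv0.ne']
      exact rpow_le_one hv0.le hv1 (by linarith)
    have hww : 1 - v ≤ (1 - m) ^ (1 - 1 / q) * T ^ (1 - 1 / q) / D := by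
      have e : (1 - m) ^ (1 - 1 / q) * T ^ (1 - 1 / q) / D =
          ((1 - m) * T / D) ^ (1 - 1 / q) * D ^ (-(1 / q)) := by
        have : D ^ (1 - 1 / q) * D ^ (1 / q) = D := by
          rw [← rpow_add hD, sub_add_cancel, rpow_one]
        rw [div_rpow (by positivity) hD.le, mul_rpow hx.le hT0.le, rpow_neg hD.le]
        nth_rw 1 [← this]
        field_simp
      have h1 : (1 - m) * T / D ≤ ((1 - m) * T / D) ^ (1 - 1 / q) := by
        have : 0 < 1 / q := by positivity
        have := rpow_le_rpow_of_exponent_ge hw0 (by linarith)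
          (show 1 - 1 / q ≤ 1 by linarith)
        rwa [rpow_one] at this
      rw [e, hw]
      nlinarith
    have hV : 0 < v ^ (b - 1) := rpow_pos_of_pos hv0 _
    have key : v ^ (b - 1) ≤ D ^ (-(1 / q)) +
        v ^ (b - 1) * ((1 - m) ^ (1 - 1 / q) * T ^ (1 - 1 / q) / D) := by
      nlinarith
    rw [eL]
    calc _ ≤ _ := div_le_div_of_nonneg_right key hD.le
      _ = _ := by field_simp
  · simp only [one_rpow, sub_self, zero_rpow hq0.ne', zero_rpow hb0.ne', sub_zero, mul_one,
      mul_zero, zero_div, div_one]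
    apply le_of_eq
    ring

theorem stmt3 (p q k : ℝ) (hp : 1 < p) (hq : 1 < q)
    (r : ℝ) (hr : r = max (p / (p - 1)) q)
    (hrq : r / q < 4 / (π ^ 2 - 8))
    (hk0 : 0 ≤ k) (hk1 : k < (1 - ((π ^ 2 - 8) * r / (4 * q)) ^ r) ^ (1 / q)) :
    Kpq p q k < 8 / (π ^ 2 - 8) := by
  have hq0 : 0 < q := by linarith
  have hp0 : 0 < p := by linarith
  have hp1 : 0 < p - 1 := by linarith
  have hr0 : 0 < r := by rw [hr]; exact lt_max_of_lt_right hq0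
  have hπ : 0 < π ^ 2 - 8 := by nlinarith [pi_gt_three]
  set b := 1 / (p / (p - 1)) with hb
  have hb0 : 0 < b := by positivity
  have hbp : p / (p - 1) = 1 / b := by rw [hb, one_div_one_div]
  have hexp : -(1 / p) = b - 1 := by rw [hb]; field_simp; ring
  set y := (π ^ 2 - 8) * r / (4 * q) with hy
  have hy0 : 0 < y := by positivity
  have hy1 : y < 1 := by
    rw [div_lt_div_iff₀ hq0 hπ] at hrq
    rw [hy, div_lt_one (by positivity)]
    linarith
  have hyr : y ^ r < 1 := rpow_lt_one hy0.le hy1 hr0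
  have hyr0 : 0 < y ^ r := rpow_pos_of_pos hy0 r
  have hm : k ^ q < 1 - y ^ r := by
    have := rpow_lt_rpow hk0 hk1 hq0
    rwa [← rpow_mul (by linarith), one_div_mul_cancel hq0.ne', rpow_one] at this
  have hm0 : 0 ≤ k ^ q := rpow_nonneg hk0 q
  have hm1 : k ^ q < 1 := by linarith
  have hx : 0 < 1 - k ^ q := by linarith
  have hyx : (1 - k ^ q) ^ (-(1 / r)) < 1 / y := by
    have h : (y ^ r) ^ (1 / r) < (1 - k ^ q) ^ (1 / r) :=
      rpow_lt_rpow hyr0.le (by linarith) (by positivity)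
    rw [← rpow_mul hy0.le, mul_one_div_cancel hr0.ne', rpow_one] at h
    rw [rpow_neg hx.le, ← one_div]
    exact one_div_lt_one_div_of_lt hy0 h
  have hK : Kpq p q k ≤ (1 - k ^ q) ^ (-(1 / r)) * (2 * (r / q)) := by
    unfold Kpq
    rw [← hb, hexp]
    have hX : 0 ≤ (1 - k ^ q) ^ (-(1 / r)) := (rpow_pos_of_pos hx _).le
    rcases max_cases (p / (p - 1)) q with ⟨h1, h2⟩ | ⟨h1, h2⟩
    · have hrb : 1 / r = b := by rw [hr, h1]
      have hr' : r = 1 / b := by rw [hr, h1, hbp]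
      refine (integral_le_rpow_neg_mul hq hb0 hm0 hm1).trans ?_
      rw [hrb] at hX ⊢
      refine mul_le_mul_of_nonneg_left ?_ hX
      have h3 : 1 / (q * b) = r / q := by rw [hr']; field_simp
      have h4 : 1 ≤ r / q := by rw [one_le_div hq0, hr, h1]; exact h2
      linarith
    · have hrq' : r = q := by rw [hr, h1]
      refine (integral_le_rpow_neg_inv_mul hq hb0 hm0 hm1).trans ?_
      rw [hrq'] at hX ⊢
      refine mul_le_mul_of_nonneg_left ?_ hX
      have h3 : 1 / (q * b) ≤ 1 := by
        rw [hbp] at h2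
        rw [← div_div, div_right_comm]
        exact (div_le_one hq0).2 h2.le
      rw [div_self hq0.ne']
      linarith
  calc Kpq p q k ≤ (1 - k ^ q) ^ (-(1 / r)) * (2 * (r / q)) := hK
    _ < 1 / y * (2 * (r / q)) := by gcongr
    _ = 8 / (π ^ 2 - 8) := by rw [hy]; field_simp; norm_num
end

section
/- Let r ∈ (1,∞). The function x ↦ (∫₀^x (1 − t^r)^{−1} dt)/x is strictly increasing on (0,1); it tends to 1 as x → 0⁺ and tends to +∞ as x → 1⁻. -/
open Real Filter Topology intervalIntegral

/-- The generalized inverse hyperbolic tangent `tanh_r^{−1}(x) = ∫₀^x (1−t^r)^{−1} dt`. -/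
noncomputable def artanhR (r x : ℝ) : ℝ := ∫ t in (0:ℝ)..x, (1 - t ^ r)⁻¹

theorem one_sub_rpow_pos {r t : ℝ} (hr : 0 < r) (h0 : 0 ≤ t) (h1 : t < 1) : 0 < 1 - t ^ r :=
  sub_pos.2 (Real.rpow_lt_one h0 h1 hr)

theorem continuousOn_one_sub_rpow_inv {r : ℝ} (hr : 0 < r) :
    ContinuousOn (fun t : ℝ => (1 - t ^ r)⁻¹) (Set.Ico 0 1) :=
  (continuous_const.sub (Real.continuous_rpow_const hr.le)).continuousOn.inv₀
    fun _ ht => (one_sub_rpow_pos hr ht.1 ht.2).ne'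

theorem artanhR_div_eq_integral (r : ℝ) {x : ℝ} (hx : x ≠ 0) :
    artanhR r x / x = ∫ u in (0:ℝ)..1, (1 - (x * u) ^ r)⁻¹ := by
  rw [intervalIntegral.integral_comp_mul_left (fun t => (1 - t ^ r)⁻¹) hx, artanhR]
  simp [div_eq_inv_mul]

theorem artanhR_div_strictMonoOn {r : ℝ} (hr : 0 < r) :
    StrictMonoOn (fun x => artanhR r x / x) (Set.Ioo (0:ℝ) 1) := by
  have hcont : ∀ x ∈ Set.Ioo (0:ℝ) 1,
      ContinuousOn (fun u : ℝ => (1 - (x * u) ^ r)⁻¹) (Set.Icc 0 1) := fun x hx =>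
    (continuousOn_one_sub_rpow_inv hr).comp (by fun_prop) fun u hu =>
      ⟨mul_nonneg hx.1.le hu.1, (mul_le_of_le_one_right hx.1.le hu.2).trans_lt hx.2⟩
  intro x hx y hy hxy
  have hpos : ∀ u ∈ Set.Icc (0:ℝ) 1, 0 < 1 - (y * u) ^ r := fun u hu =>
    one_sub_rpow_pos hr (mul_nonneg hy.1.le hu.1)
      ((mul_le_of_le_one_right hy.1.le hu.2).trans_lt hy.2)
  simp only [artanhR_div_eq_integral r hx.1.ne', artanhR_div_eq_integral r hy.1.ne']
  refine integral_lt_integral_of_continuousOn_of_le_of_exists_lt one_pos (hcont x hx)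
    (hcont y hy) (fun u hu => ?_) ⟨1, by simp, ?_⟩
  · refine inv_anti₀ (hpos u ⟨hu.1.le, hu.2⟩) (sub_le_sub_left ?_ 1)
    exact Real.rpow_le_rpow (mul_nonneg hx.1.le hu.1.le)
      (mul_le_mul_of_nonneg_right hxy.le hu.1.le) hr.le
  · refine inv_strictAnti₀ (hpos 1 (by simp)) (sub_lt_sub_left ?_ 1)
    simpa using Real.rpow_lt_rpow hx.1.le hxy hr

theorem hasDerivAt_artanhR_zero {r : ℝ} (hr : 0 < r) : HasDerivAt (artanhR r) 1 0 := by
  have hcont : ContinuousAt (fun t : ℝ => (1 - t ^ r)⁻¹) 0 := by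
    refine (continuous_const.sub (Real.continuous_rpow_const hr.le)).continuousAt.inv₀ ?_
    simp [Real.zero_rpow hr.ne']
  have hmeas : Measurable (fun t : ℝ => (1 - t ^ r)⁻¹) := by fun_prop
  have h := integral_hasDerivAt_right (a := (0:ℝ)) (b := 0)
    (f := fun t : ℝ => (1 - t ^ r)⁻¹) (by simp)
    hmeas.stronglyMeasurable.stronglyMeasurableAtFilter hcont
  simp only [Real.zero_rpow hr.ne', sub_zero, inv_one] at h
  exact h

theorem artanhR_div_tendsto_one {r : ℝ} (hr : 0 < r) :
    Tendsto (fun x => artanhR r x / x) (𝓝[>] 0) (𝓝 1) := by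
  have h := (hasDerivAt_iff_tendsto_slope.1 (hasDerivAt_artanhR_zero hr)).mono_left
    (nhdsWithin_mono 0 fun x (hx : 0 < x) => hx.ne')
  refine h.congr fun x => ?_
  simp [slope_def_field, artanhR]

theorem neg_log_one_sub_div_le_artanhR {r x : ℝ} (hr : 1 ≤ r) (h0 : 0 ≤ x) (h1 : x < 1) :
    r⁻¹ * -Real.log (1 - x) ≤ artanhR r x := by
  have hr0 : 0 < r := one_pos.trans_le hr
  have hlog : ∫ t in (0:ℝ)..x, (1 - t)⁻¹ = -Real.log (1 - x) := by
    rw [intervalIntegral.integral_comp_sub_left (fun t => t⁻¹) 1,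
      integral_inv_of_pos (by linarith) (by norm_num)]
    simp
  have hsub : Set.uIcc 0 x ⊆ Set.Ico 0 1 := by
    rw [Set.uIcc_of_le h0]
    exact fun t ht => ⟨ht.1, ht.2.trans_lt h1⟩
  have hinv : ContinuousOn (fun t : ℝ => r⁻¹ * (1 - t)⁻¹) (Set.Ico 0 1) :=
    continuousOn_const.mul ((continuousOn_const.sub continuousOn_id).inv₀
      fun t ht => (sub_pos.2 ht.2).ne')
  rw [← hlog, ← intervalIntegral.integral_const_mul, artanhR]
  refine integral_mono_on h0 (hinv.mono hsub).intervalIntegrable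
    ((continuousOn_one_sub_rpow_inv hr0).mono hsub).intervalIntegrable fun t ht => ?_
  rw [← mul_inv]
  refine inv_anti₀ (one_sub_rpow_pos hr0 ht.1 (ht.2.trans_lt h1)) ?_
  have hb := one_add_mul_self_le_rpow_one_add (s := t - 1) (by linarith [ht.1]) hr
  rw [add_sub_cancel] at hb
  linarith

theorem artanhR_div_tendsto_atTop {r : ℝ} (hr : 1 ≤ r) :
    Tendsto (fun x => artanhR r x / x) (𝓝[<] 1) atTop := by
  have hr0 : 0 < r := one_pos.trans_le hr
  have hsub : Tendsto (fun x : ℝ => 1 - x) (𝓝[<] 1) (𝓝[>] 0) := by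
    refine tendsto_nhdsWithin_iff.2 ⟨?_, ?_⟩
    · have : Tendsto (fun x : ℝ => 1 - x) (𝓝 1) (𝓝 (1 - 1)) :=
        (continuous_const.sub continuous_id).tendsto 1
      rw [sub_self] at this
      exact this.mono_left nhdsWithin_le_nhds
    · filter_upwards [self_mem_nhdsWithin] with x hx using sub_pos.2 (Set.mem_Iio.1 hx)
  have hlog : Tendsto (fun x : ℝ => r⁻¹ * -Real.log (1 - x)) (𝓝[<] 1) atTop :=
    (tendsto_neg_atBot_atTop.comp (Real.tendsto_log_nhdsGT_zero.comp hsub)).const_mul_atTop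
      (inv_pos.2 hr0)
  refine tendsto_atTop_mono' _ ?_ hlog
  filter_upwards [Ioo_mem_nhdsLT one_pos] with x hx
  have hle := neg_log_one_sub_div_le_artanhR hr hx.1.le hx.2
  have hnonneg : 0 ≤ r⁻¹ * -Real.log (1 - x) :=
    mul_nonneg (inv_pos.2 hr0).le (neg_nonneg.2
      (Real.log_nonpos (sub_nonneg.2 hx.2.le) (by linarith [hx.1])))
  exact hle.trans (le_div_self (hnonneg.trans hle) hx.1 hx.2.le)

theorem stmt5 (r : ℝ) (hr : 1 < r) :
    StrictMonoOn (fun x => artanhR r x / x) (Set.Ioo (0:ℝ) 1) ∧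
    Tendsto (fun x => artanhR r x / x) (𝓝[>] 0) (𝓝 1) ∧
    Tendsto (fun x => artanhR r x / x) (𝓝[<] 1) atTop :=
  ⟨artanhR_div_strictMonoOn (one_pos.trans hr), artanhR_div_tendsto_one (one_pos.trans hr),
    artanhR_div_tendsto_atTop hr.le⟩
end

section
/- Let q ∈ (1,∞), k ∈ [0,1), and 1 < p < ρ < ∞. Then for every t ∈ (0,1]: (i) F_{ρq,k}(t) < F_{pq,k}(t), and (ii) F_{pq,k}(t)/K_{pq}(k) ≤ F_{ρq,k}(t)/K_{ρq}(k). (Equivalently, the generalized Jacobian elliptic function p ↦ sn_{pq}(2K_{pq}(k)x, k) is decreasing in p for each fixed x ∈ [0,1].) -/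
open Real intervalIntegral

/-- `F_{pq,k}(y) = ∫₀^y (1−t^q)^{−1/p}(1−k^q t^q)^{−1/p'} dt`, the inverse of `sn_{pq}(·,k)`. -/
noncomputable def Fpq (p q k y : ℝ) : ℝ :=
  ∫ t in (0:ℝ)..y, (1 - t ^ q) ^ (-(1 / p)) * (1 - k ^ q * t ^ q) ^ (-(1 / (p / (p - 1))))

/-- The integrand of `Fpq` and `Kpq`. -/
noncomputable def integrandPQ (p q k t : ℝ) : ℝ :=
  (1 - t ^ q) ^ (-(1 / p)) * (1 - k ^ q * t ^ q) ^ (-(1 / (p / (p - 1))))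

/-- The ratio `(1 - k^q t^q) / (1 - t^q)`. -/
noncomputable def ratioPQ (q k t : ℝ) : ℝ := (1 - k ^ q * t ^ q) / (1 - t ^ q)

lemma mul_rpow_lt_one {q k t : ℝ} (hq : 1 < q) (hk0 : 0 ≤ k) (hk1 : k < 1)
    (ht0 : 0 ≤ t) (ht1 : t ≤ 1) : k ^ q * t ^ q < 1 := by
  have hm := rpow_lt_one hk0 hk1 (by linarith : 0 < q)
  have hm0 := rpow_nonneg hk0 q
  have hu := rpow_le_one ht0 ht1 (by linarith : 0 ≤ q)
  nlinarith

lemma integrandPQ_pos {p q k t : ℝ} (hq : 1 < q) (hk0 : 0 ≤ k) (hk1 : k < 1)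
    (ht : t ∈ Set.Ioo (0 : ℝ) 1) : 0 < integrandPQ p q k t := by
  have hu := rpow_lt_one ht.1.le ht.2 (by linarith : 0 < q)
  have hB := mul_rpow_lt_one hq hk0 hk1 ht.1.le ht.2.le
  exact mul_pos (rpow_pos_of_pos (by linarith) _) (rpow_pos_of_pos (by linarith) _)

lemma one_lt_ratioPQ {q k t : ℝ} (hq : 1 < q) (hk0 : 0 ≤ k) (hk1 : k < 1)
    (ht : t ∈ Set.Ioo (0 : ℝ) 1) : 1 < ratioPQ q k t := by
  have hu := rpow_lt_one ht.1.le ht.2 (by linarith : 0 < q)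
  have hu0 := rpow_pos_of_pos ht.1 q
  have hm := rpow_lt_one hk0 hk1 (by linarith : 0 < q)
  rw [ratioPQ, one_lt_div (by linarith)]
  nlinarith

lemma ratioPQ_le_ratioPQ {q k s t : ℝ} (hq : 1 < q) (hk0 : 0 ≤ k) (hk1 : k < 1)
    (hs : 0 ≤ s) (hst : s ≤ t) (ht : t < 1) : ratioPQ q k s ≤ ratioPQ q k t := by
  have hu := rpow_lt_one (hs.trans hst) ht (by linarith : 0 < q)
  have hsu := rpow_le_rpow hs hst (by linarith : 0 ≤ q)
  have hm := rpow_lt_one hk0 hk1 (by linarith : 0 < q)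
  rw [ratioPQ, ratioPQ, div_le_div_iff₀ (by linarith) (by linarith)]
  nlinarith [mul_nonneg (sub_nonneg.2 hsu) (sub_nonneg.2 hm.le)]

lemma integrandPQ_eq_ratioPQ_mul {p ρ q k t : ℝ} (hp : 1 < p) (hρ : 1 < ρ) (hq : 1 < q)
    (hk0 : 0 ≤ k) (hk1 : k < 1) (ht : t ∈ Set.Ioo (0 : ℝ) 1) :
    integrandPQ p q k t = ratioPQ q k t ^ (1 / p - 1 / ρ) * integrandPQ ρ q k t := by
  have hu := rpow_lt_one ht.1.le ht.2 (by linarith : 0 < q)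
  have hB := mul_rpow_lt_one hq hk0 hk1 ht.1.le ht.2.le
  have hA : 0 < 1 - t ^ q := by linarith
  have hB' : 0 < 1 - k ^ q * t ^ q := by linarith
  have conj : ∀ r : ℝ, 1 < r → -(1 / (r / (r - 1))) = 1 / r - 1 := by
    intro r hr
    have h1 : r ≠ 0 := by linarith
    have h2 : r - 1 ≠ 0 := by linarith
    field_simp
    ring
  rw [integrandPQ, integrandPQ, ratioPQ, conj p hp, conj ρ hρ, div_rpow hB'.le hA.le,
    div_eq_mul_inv (_ ^ (1 / p - 1 / ρ)), ← rpow_neg hA.le]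
  calc _ = (1 - t ^ q) ^ (-(1 / p - 1 / ρ) + -(1 / ρ)) *
        (1 - k ^ q * t ^ q) ^ ((1 / p - 1 / ρ) + (1 / ρ - 1)) := by congr 2 <;> ring
    _ = _ := by
      rw [rpow_add hA, rpow_add hB']
      ring

lemma intervalIntegrable_integrandPQ {p q k : ℝ} (hp : 1 < p) (hq : 1 < q) (hk0 : 0 ≤ k)
    (hk1 : k < 1) : IntervalIntegrable (integrandPQ p q k) MeasureTheory.volume 0 1 := by
  have hp' : 1 / p < 1 := by rw [div_lt_one (by linarith)]; exact hp
  have hp0 : 0 < 1 / p := by positivity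
  have hr0 : 0 ≤ 1 / (p / (p - 1)) := by
    have : 0 < p - 1 := by linarith
    positivity
  have hm := rpow_lt_one hk0 hk1 (by linarith : 0 < q)
  have hm0 := rpow_nonneg hk0 q
  have hbase : IntervalIntegrable (fun x : ℝ => (1 - x) ^ (-(1 / p))) MeasureTheory.volume 0 1 := by
    have := ((intervalIntegrable_rpow' (a := 0) (b := 1)
      (by linarith : -1 < -(1 / p))).comp_sub_left 1).symm
    simpa using this
  refine (hbase.mul_const ((1 - k ^ q) ^ (-(1 / (p / (p - 1)))))).mono_fun' ?_ ?_
  · apply Measurable.aestronglyMeasurable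
    unfold integrandPQ
    fun_prop
  · rw [Set.uIoc_of_le zero_le_one, Filter.EventuallyLE, MeasureTheory.ae_restrict_iff' measurableSet_Ioc]
    have hne : ∀ᵐ x : ℝ, x ≠ 1 := MeasureTheory.Measure.ae_ne _ _
    filter_upwards [hne] with x hx1 hx
    have hx' : x ∈ Set.Ioo (0 : ℝ) 1 := ⟨hx.1, lt_of_le_of_ne hx.2 hx1⟩
    rw [Real.norm_of_nonneg (integrandPQ_pos hq hk0 hk1 hx').le, integrandPQ]
    have hu := rpow_lt_one hx'.1.le hx'.2 (by linarith : 0 < q)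
    have hu1 : x ^ q ≤ x := by
      simpa using rpow_le_rpow_of_exponent_ge hx'.1 hx'.2.le hq.le
    have hB := mul_rpow_lt_one hq hk0 hk1 hx'.1.le hx'.2.le
    have h1x : 0 < 1 - x := by linarith [hx'.2]
    refine mul_le_mul (rpow_le_rpow_of_nonpos h1x (by linarith) (by linarith))
      (rpow_le_rpow_of_nonpos (by linarith) (by nlinarith) (by linarith))
      (rpow_nonneg (by linarith) _) (rpow_nonneg h1x.le _)

theorem stmt6 (p ρ q k : ℝ) (hq : 1 < q) (hk0 : 0 ≤ k) (hk1 : k < 1)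
    (hp : 1 < p) (hpρ : p < ρ) (t : ℝ) (ht0 : 0 < t) (ht1 : t ≤ 1) :
    Fpq ρ q k t < Fpq p q k t ∧
    Fpq p q k t / Kpq p q k ≤ Fpq ρ q k t / Kpq ρ q k := by
  have hρ : 1 < ρ := hp.trans hpρ
  have hexp : 0 < 1 / p - 1 / ρ := sub_pos.2 (one_div_lt_one_div_of_lt (by linarith) hpρ)
  have hIp := intervalIntegrable_integrandPQ hp hq hk0 hk1
  have hIρ := intervalIntegrable_integrandPQ hρ hq hk0 hk1
  have hsub0 : Set.uIcc 0 t ⊆ Set.uIcc (0 : ℝ) 1 := by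
    rw [Set.uIcc_of_le ht0.le, Set.uIcc_of_le zero_le_one]
    exact Set.Icc_subset_Icc le_rfl ht1
  have hsub1 : Set.uIcc t 1 ⊆ Set.uIcc (0 : ℝ) 1 := by
    rw [Set.uIcc_of_le ht1, Set.uIcc_of_le zero_le_one]
    exact Set.Icc_subset_Icc ht0.le le_rfl
  have hIp0 := hIp.mono_set hsub0
  have hIρ0 := hIρ.mono_set hsub0
  have hIp1 := hIp.mono_set hsub1
  have hIρ1 := hIρ.mono_set hsub1
  change (∫ x in (0:ℝ)..t, integrandPQ ρ q k x) < (∫ x in (0:ℝ)..t, integrandPQ p q k x) ∧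
    (∫ x in (0:ℝ)..t, integrandPQ p q k x) / (∫ x in (0:ℝ)..1, integrandPQ p q k x) ≤
    (∫ x in (0:ℝ)..t, integrandPQ ρ q k x) / (∫ x in (0:ℝ)..1, integrandPQ ρ q k x)
  have hKp : 0 < ∫ x in (0:ℝ)..1, integrandPQ p q k x :=
    intervalIntegral_pos_of_pos_on hIp (fun x hx => integrandPQ_pos hq hk0 hk1 hx) one_pos
  have hKρ : 0 < ∫ x in (0:ℝ)..1, integrandPQ ρ q k x :=
    intervalIntegral_pos_of_pos_on hIρ (fun x hx => integrandPQ_pos hq hk0 hk1 hx) one_pos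
  constructor
  · rw [← sub_pos, ← integral_sub hIp0 hIρ0]
    refine intervalIntegral_pos_of_pos_on (hIp0.sub hIρ0) (fun x hx => ?_) ht0
    have hx' : x ∈ Set.Ioo (0 : ℝ) 1 := ⟨hx.1, hx.2.trans_le ht1⟩
    rw [integrandPQ_eq_ratioPQ_mul hp hρ hq hk0 hk1 hx']
    have h1 := one_lt_rpow (one_lt_ratioPQ hq hk0 hk1 hx') hexp
    have h2 := integrandPQ_pos (p := ρ) hq hk0 hk1 hx'
    nlinarith
  · rcases ht1.eq_or_lt with rfl | ht1'
    · rw [div_self hKp.ne', div_self hKρ.ne']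
    · set c := ratioPQ q k t ^ (1 / p - 1 / ρ)
      have hle : (∫ x in (0:ℝ)..t, integrandPQ p q k x) ≤
          c * ∫ x in (0:ℝ)..t, integrandPQ ρ q k x := by
        rw [← integral_const_mul]
        refine integral_mono_on_of_le_Ioo ht0.le hIp0 (hIρ0.const_mul c) fun x hx => ?_
        have hx' : x ∈ Set.Ioo (0 : ℝ) 1 := ⟨hx.1, hx.2.trans ht1'⟩
        rw [integrandPQ_eq_ratioPQ_mul hp hρ hq hk0 hk1 hx']
        exact mul_le_mul_of_nonneg_right (rpow_le_rpow
          (zero_lt_one.trans (one_lt_ratioPQ hq hk0 hk1 hx')).le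
          (ratioPQ_le_ratioPQ hq hk0 hk1 hx.1.le hx.2.le ht1') hexp.le)
          (integrandPQ_pos hq hk0 hk1 hx').le
      have hge : c * (∫ x in t..1, integrandPQ ρ q k x) ≤
          ∫ x in t..1, integrandPQ p q k x := by
        rw [← integral_const_mul]
        refine integral_mono_on_of_le_Ioo ht1 (hIρ1.const_mul c) hIp1 fun x hx => ?_
        have hx' : x ∈ Set.Ioo (0 : ℝ) 1 := ⟨ht0.trans hx.1, hx.2⟩
        rw [integrandPQ_eq_ratioPQ_mul hp hρ hq hk0 hk1 hx']
        exact mul_le_mul_of_nonneg_right (rpow_le_rpow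
          (zero_lt_one.trans (one_lt_ratioPQ hq hk0 hk1 ⟨ht0, ht1'⟩)).le
          (ratioPQ_le_ratioPQ hq hk0 hk1 ht0.le hx.1.le hx.2) hexp.le)
          (integrandPQ_pos hq hk0 hk1 hx').le
      have hFρ : 0 < ∫ x in (0:ℝ)..t, integrandPQ ρ q k x :=
        intervalIntegral_pos_of_pos_on hIρ0
          (fun x hx => integrandPQ_pos hq hk0 hk1 ⟨hx.1, hx.2.trans ht1'⟩) ht0
      have hGρ : 0 < ∫ x in t..1, integrandPQ ρ q k x :=
        intervalIntegral_pos_of_pos_on hIρ1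
          (fun x hx => integrandPQ_pos hq hk0 hk1 ⟨ht0.trans hx.1, hx.2⟩) ht1'
      rw [div_le_div_iff₀ hKp hKρ, ← integral_add_adjacent_intervals hIp0 hIp1,
        ← integral_add_adjacent_intervals hIρ0 hIρ1]
      have h1 := mul_le_mul_of_nonneg_right hle hGρ.le
      have h2 := mul_le_mul_of_nonneg_left hge hFρ.le
      linarith
end

section
/- Let p ∈ (1,∞), k ∈ [0,1), and 1 < q < σ < ∞. Then for every t ∈ (0,1]: (i) F_{pσ,k}(t) < F_{pq,k}(t), and (ii) F_{pq,k}(t)/K_{pq}(k) ≤ F_{pσ,k}(t)/K_{pσ}(k). (Equivalently, the generalized Jacobian elliptic function q ↦ sn_{pq}(2K_{pq}(k)x, k) is decreasing in q for each fixed x ∈ [0,1].) -/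
open Real intervalIntegral

/-- The ratio `(1 - s ^ σ) / (1 - s ^ q)` is increasing in `s`. -/
theorem one_sub_rpow_div_mono {q σ s t : ℝ} (hq : 0 < q) (hqσ : q ≤ σ) (hs : 0 ≤ s)
    (hst : s ≤ t) (ht : t < 1) :
    (1 - s ^ σ) / (1 - s ^ q) ≤ (1 - t ^ σ) / (1 - t ^ q) := by
  have ht0 : 0 ≤ t := hs.trans hst
  have hr : 1 ≤ σ / q := (one_le_div hq).2 hqσ
  have hσ : q * (σ / q) = σ := mul_div_cancel₀ σ hq.ne'
  have h := (convexOn_rpow hr).secant_mono (a := 1) (x := s ^ q) (y := t ^ q)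
    (Set.mem_Ici.2 zero_le_one) (Set.mem_Ici.2 (rpow_nonneg hs q))
    (Set.mem_Ici.2 (rpow_nonneg ht0 q))
    (rpow_lt_one hs (hst.trans_lt ht) hq).ne (rpow_lt_one ht0 ht hq).ne
    (rpow_le_rpow hs hst hq.le)
  rw [← rpow_mul hs, ← rpow_mul ht0, hσ, one_rpow, ← neg_div_neg_eq,
    ← neg_div_neg_eq (t ^ σ - 1)] at h
  simpa only [neg_sub] using h

/-- The integrand of `Fpq`, with arbitrary exponents `-a` and `-b`. -/
noncomputable def jacobiIntegrand (a b q k s : ℝ) : ℝ :=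
  (1 - s ^ q) ^ (-a) * (1 - k ^ q * s ^ q) ^ (-b)

section

variable {a b q σ k s t : ℝ}

theorem one_sub_rpow_pos_s7 (hq : 0 < q) (hs0 : 0 ≤ s) (hs1 : s < 1) : 0 < 1 - s ^ q :=
  sub_pos.2 (rpow_lt_one hs0 hs1 hq)

theorem one_sub_rpow_mul_rpow_pos (hq : 0 < q) (hk0 : 0 ≤ k) (hk1 : k < 1) (hs0 : 0 ≤ s)
    (hs1 : s ≤ 1) : 0 < 1 - k ^ q * s ^ q :=
  sub_pos.2 ((mul_le_of_le_one_right (rpow_nonneg hk0 q) (rpow_le_one hs0 hs1 hq.le)).trans_lt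
    (rpow_lt_one hk0 hk1 hq))

theorem jacobiIntegrand_pos (hq : 0 < q) (hk0 : 0 ≤ k) (hk1 : k < 1) (hs0 : 0 ≤ s)
    (hs1 : s < 1) : 0 < jacobiIntegrand a b q k s :=
  mul_pos (rpow_pos_of_pos (one_sub_rpow_pos_s7 hq hs0 hs1) _)
    (rpow_pos_of_pos (one_sub_rpow_mul_rpow_pos hq hk0 hk1 hs0 hs1.le) _)

theorem jacobiIntegrand_lt (ha : 0 < a) (hb : 0 ≤ b) (hq : 0 < q) (hqσ : q < σ) (hk0 : 0 ≤ k)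
    (hk1 : k < 1) (hs0 : 0 < s) (hs1 : s < 1) :
    jacobiIntegrand a b σ k s < jacobiIntegrand a b q k s := by
  have hσ : 0 < σ := hq.trans hqσ
  have hpow : s ^ σ < s ^ q := rpow_lt_rpow_of_exponent_gt hs0 hs1 hqσ
  have hkpow : k ^ σ ≤ k ^ q := rpow_le_rpow_of_exponent_ge' hk0 hk1.le hq.le hqσ.le
  have hmul : k ^ σ * s ^ σ ≤ k ^ q * s ^ q :=
    mul_le_mul hkpow hpow.le (rpow_nonneg hs0.le _) (rpow_nonneg hk0 _)
  exact mul_lt_mul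
    (rpow_lt_rpow_of_neg (one_sub_rpow_pos_s7 hq hs0.le hs1) (by linarith) (by linarith))
    (rpow_le_rpow_of_nonpos (one_sub_rpow_mul_rpow_pos hq hk0 hk1 hs0.le hs1.le)
      (by linarith) (by linarith))
    (rpow_pos_of_pos (one_sub_rpow_mul_rpow_pos hσ hk0 hk1 hs0.le hs1.le) _)
    (rpow_nonneg (one_sub_rpow_pos_s7 hq hs0.le hs1).le _)

theorem jacobiIntegrand_eq_mul (hq : 0 < q) (hσ : 0 < σ) (hk0 : 0 ≤ k)
    (hk1 : k < 1) (hs0 : 0 ≤ s) (hs1 : s < 1) :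
    jacobiIntegrand a b q k s =
      ((1 - s ^ σ) / (1 - s ^ q)) ^ a * ((1 - (k * s) ^ σ) / (1 - (k * s) ^ q)) ^ b *
        jacobiIntegrand a b σ k s := by
  have h₁ := one_sub_rpow_pos_s7 hq hs0 hs1
  have h₂ := one_sub_rpow_pos_s7 hσ hs0 hs1
  have h₃ := one_sub_rpow_mul_rpow_pos hq hk0 hk1 hs0 hs1.le
  have h₄ := one_sub_rpow_mul_rpow_pos hσ hk0 hk1 hs0 hs1.le
  have h₅ := rpow_pos_of_pos h₂ a
  have h₆ := rpow_pos_of_pos h₄ b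
  have h₇ := rpow_pos_of_pos h₁ a
  have h₈ := rpow_pos_of_pos h₃ b
  rw [jacobiIntegrand, jacobiIntegrand, mul_rpow hk0 hs0, mul_rpow hk0 hs0,
    div_rpow h₂.le h₁.le, div_rpow h₄.le h₃.le, rpow_neg h₁.le, rpow_neg h₂.le,
    rpow_neg h₃.le, rpow_neg h₄.le]
  generalize (1 - s ^ σ) ^ a = A at h₅ ⊢
  generalize (1 - k ^ σ * s ^ σ) ^ b = B at h₆ ⊢
  generalize (1 - s ^ q) ^ a = C at h₇ ⊢
  generalize (1 - k ^ q * s ^ q) ^ b = D at h₈ ⊢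
  field_simp

/-- The quotient of the integrands for `q ≤ σ` is increasing, in cross-multiplied form. -/
theorem jacobiIntegrand_mul_le (ha : 0 ≤ a) (hb : 0 ≤ b) (hq : 0 < q) (hqσ : q ≤ σ)
    (hk0 : 0 ≤ k) (hk1 : k < 1) (hs0 : 0 ≤ s) (hst : s ≤ t) (ht1 : t < 1) :
    jacobiIntegrand a b q k s * jacobiIntegrand a b σ k t ≤
      jacobiIntegrand a b q k t * jacobiIntegrand a b σ k s := by
  have hσ : 0 < σ := hq.trans_le hqσ
  have ht0 : 0 ≤ t := hs0.trans hst
  have hs1 : s < 1 := hst.trans_lt ht1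
  have hks : 0 ≤ k * s := mul_nonneg hk0 hs0
  have hkst : k * s ≤ k * t := mul_le_mul_of_nonneg_left hst hk0
  have hkt : k * t < 1 := mul_lt_one_of_nonneg_of_lt_one_left hk0 hk1 ht1.le
  have hks1 : k * s < 1 := hkst.trans_lt hkt
  have hratio {x : ℝ} (hx0 : 0 ≤ x) (hx1 : x < 1) : 0 ≤ (1 - x ^ σ) / (1 - x ^ q) :=
    (div_pos (one_sub_rpow_pos_s7 hσ hx0 hx1) (one_sub_rpow_pos_s7 hq hx0 hx1)).le
  have hmono := mul_le_mul
    (rpow_le_rpow (hratio hs0 hs1) (one_sub_rpow_div_mono hq hqσ hs0 hst ht1) ha)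
    (rpow_le_rpow (hratio hks hks1) (one_sub_rpow_div_mono hq hqσ hks hkst hkt) hb)
    (rpow_nonneg (hratio hks hks1) b) (rpow_nonneg (hratio ht0 ht1) a)
  rw [jacobiIntegrand_eq_mul (q := q) hq hσ hk0 hk1 hs0 hs1,
    jacobiIntegrand_eq_mul (q := q) hq hσ hk0 hk1 ht0 ht1,
    mul_right_comm _ (jacobiIntegrand a b σ k t) (jacobiIntegrand a b σ k s)]
  exact mul_le_mul_of_nonneg_right
    (mul_le_mul_of_nonneg_right hmono (jacobiIntegrand_pos hσ hk0 hk1 hs0 hs1).le)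
    (jacobiIntegrand_pos hσ hk0 hk1 ht0 ht1).le

theorem intervalIntegrable_jacobiIntegrand_zero_one (ha0 : 0 ≤ a) (ha1 : a < 1) (hb : 0 ≤ b)
    (hq : 1 ≤ q) (hk0 : 0 ≤ k) (hk1 : k < 1) :
    IntervalIntegrable (jacobiIntegrand a b q k) MeasureTheory.volume 0 1 := by
  have hq0 : 0 < q := zero_lt_one.trans_le hq
  have hdom : IntervalIntegrable (fun s : ℝ => (1 - s) ^ (-a) * (1 - k ^ q) ^ (-b))
      MeasureTheory.volume 0 1 := by
    have h := (intervalIntegrable_rpow' (a := 0) (b := 1) (neg_lt_neg ha1)).comp_sub_left 1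
    simp only [sub_zero, sub_self] at h
    exact h.symm.mul_const _
  rw [intervalIntegrable_iff_integrableOn_Ioo_of_le zero_le_one] at hdom ⊢
  refine hdom.mono' ?_ ?_
  · have hmeas : Measurable (jacobiIntegrand a b q k) := by
      unfold jacobiIntegrand
      fun_prop
    exact hmeas.aestronglyMeasurable
  · refine (MeasureTheory.ae_restrict_iff' measurableSet_Ioo).2 (.of_forall fun s hs => ?_)
    rw [norm_of_nonneg (jacobiIntegrand_pos hq0 hk0 hk1 hs.1.le hs.2).le]
    have hpow : s ^ q ≤ s := by
      simpa using rpow_le_rpow_of_exponent_ge hs.1 hs.2.le hq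
    have hkpow : k ^ q * s ^ q ≤ k ^ q :=
      mul_le_of_le_one_right (rpow_nonneg hk0 q) (rpow_le_one hs.1.le hs.2.le hq0.le)
    exact mul_le_mul
      (rpow_le_rpow_of_nonpos (sub_pos.2 hs.2) (by linarith) (by linarith))
      (rpow_le_rpow_of_nonpos (one_sub_rpow_pos_s7 hq0 hk0 hk1) (by linarith) (by linarith))
      (rpow_nonneg (one_sub_rpow_mul_rpow_pos hq0 hk0 hk1 hs.1.le hs.2.le).le _)
      (rpow_nonneg (sub_pos.2 hs.2).le _)

theorem intervalIntegrable_jacobiIntegrand (ha0 : 0 ≤ a) (ha1 : a < 1) (hb : 0 ≤ b)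
    (hq : 1 ≤ q) (hk0 : 0 ≤ k) (hk1 : k < 1) (hs : s ∈ Set.Icc (0 : ℝ) 1)
    (ht : t ∈ Set.Icc (0 : ℝ) 1) :
    IntervalIntegrable (jacobiIntegrand a b q k) MeasureTheory.volume s t := by
  refine (intervalIntegrable_jacobiIntegrand_zero_one ha0 ha1 hb hq hk0 hk1).mono_set ?_
  rw [Set.uIcc_of_le zero_le_one]
  exact Set.uIcc_subset_Icc hs ht

end

theorem integral_div_integral_le_of_mul_le {f g : ℝ → ℝ} {x y z : ℝ} (hxy : x < y) (hyz : y < z)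
    (hf : IntervalIntegrable f MeasureTheory.volume x z)
    (hg : IntervalIntegrable g MeasureTheory.volume x z)
    (hf0 : ∀ s ∈ Set.Ioo x z, 0 < f s) (hg0 : ∀ s ∈ Set.Ioo x z, 0 < g s)
    (hfg : ∀ s ∈ Set.Ioo x z, ∀ t ∈ Set.Ioo x z, s ≤ t → f s * g t ≤ f t * g s) :
    (∫ s in x..y, f s) / (∫ s in x..z, f s) ≤ (∫ s in x..y, g s) / (∫ s in x..z, g s) := by
  have hxz := hxy.trans hyz
  have hy : y ∈ Set.Ioo x z := ⟨hxy, hyz⟩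
  have hleft : Set.uIcc x y ⊆ Set.uIcc x z :=
    Set.uIcc_subset_uIcc_left (Set.mem_uIcc_of_le hxy.le hyz.le)
  have hright : Set.uIcc y z ⊆ Set.uIcc x z :=
    Set.uIcc_subset_uIcc_right (Set.mem_uIcc_of_le hxy.le hyz.le)
  have hf₁ := hf.mono_set hleft
  have hf₂ := hf.mono_set hright
  have hg₁ := hg.mono_set hleft
  have hg₂ := hg.mono_set hright
  have hpos_left : 0 ≤ ∫ s in x..y, g s :=
    (intervalIntegral_pos_of_pos_on hg₁ (fun s hs => hg0 s ⟨hs.1, hs.2.trans hyz⟩) hxy).le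
  have hpos_right : 0 ≤ ∫ s in y..z, g s :=
    (intervalIntegral_pos_of_pos_on hg₂ (fun s hs => hg0 s ⟨hxy.trans hs.1, hs.2⟩) hyz).le
  have hle_left : (∫ s in x..y, f s) * g y ≤ f y * ∫ s in x..y, g s := by
    rw [← integral_mul_const, ← integral_const_mul]
    exact integral_mono_on_of_le_Ioo hxy.le (hf₁.mul_const _) (hg₁.const_mul _)
      fun s hs => hfg s ⟨hs.1, hs.2.trans hyz⟩ y hy hs.2.le
  have hle_right : f y * (∫ s in y..z, g s) ≤ (∫ s in y..z, f s) * g y := by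
    rw [← integral_mul_const, ← integral_const_mul]
    exact integral_mono_on_of_le_Ioo hyz.le (hg₂.const_mul _) (hf₂.mul_const _)
      fun s hs => hfg y hy s ⟨hxy.trans hs.1, hs.2⟩ hs.1.le
  rw [div_le_div_iff₀ (intervalIntegral_pos_of_pos_on hf hf0 hxz)
    (intervalIntegral_pos_of_pos_on hg hg0 hxz),
    ← integral_add_adjacent_intervals hf₁ hf₂, ← integral_add_adjacent_intervals hg₁ hg₂]
  have hcross : (∫ s in x..y, f s) * (∫ s in y..z, g s) ≤
      (∫ s in x..y, g s) * ∫ s in y..z, f s := by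
    refine le_of_mul_le_mul_right ?_ (hg0 y hy)
    calc (∫ s in x..y, f s) * (∫ s in y..z, g s) * g y
        = (∫ s in x..y, f s) * g y * ∫ s in y..z, g s := by ring
      _ ≤ f y * (∫ s in x..y, g s) * ∫ s in y..z, g s :=
          mul_le_mul_of_nonneg_right hle_left hpos_right
      _ = (∫ s in x..y, g s) * (f y * ∫ s in y..z, g s) := by ring
      _ ≤ (∫ s in x..y, g s) * ((∫ s in y..z, f s) * g y) :=
          mul_le_mul_of_nonneg_left hle_right hpos_left
      _ = (∫ s in x..y, g s) * (∫ s in y..z, f s) * g y := by ring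
  linarith

theorem stmt7 (p q σ k : ℝ) (hp : 1 < p) (hk0 : 0 ≤ k) (hk1 : k < 1)
    (hq : 1 < q) (hqσ : q < σ) (t : ℝ) (ht0 : 0 < t) (ht1 : t ≤ 1) :
    Fpq p σ k t < Fpq p q k t ∧
    Fpq p q k t / Kpq p q k ≤ Fpq p σ k t / Kpq p σ k := by
  have hp0 : 0 < p := zero_lt_one.trans hp
  have ha : 0 < 1 / p := one_div_pos.2 hp0
  have ha1 : 1 / p < 1 := (div_lt_one hp0).2 hp
  have hb : 0 ≤ 1 / (p / (p - 1)) :=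
    (one_div_pos.2 (div_pos hp0 (sub_pos.2 hp))).le
  have hσ : 1 < σ := hq.trans hqσ
  have hq0 : 0 < q := zero_lt_one.trans hq
  have hσ0 : 0 < σ := zero_lt_one.trans hσ
  have hF (r y : ℝ) :
      Fpq p r k y = ∫ s in (0 : ℝ)..y, jacobiIntegrand (1 / p) (1 / (p / (p - 1))) r k s := rfl
  have hK (r : ℝ) : Kpq p r k = Fpq p r k 1 := rfl
  have hint {r : ℝ} (hr : 1 < r) {y : ℝ} (hy : y ∈ Set.Icc (0 : ℝ) 1) :
      IntervalIntegrable (jacobiIntegrand (1 / p) (1 / (p / (p - 1))) r k)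
        MeasureTheory.volume 0 y :=
    intervalIntegrable_jacobiIntegrand ha.le ha1 hb hr.le hk0 hk1
      (Set.left_mem_Icc.2 zero_le_one) hy
  have hone : (1 : ℝ) ∈ Set.Icc (0 : ℝ) 1 := Set.right_mem_Icc.2 zero_le_one
  have ht : t ∈ Set.Icc (0 : ℝ) 1 := ⟨ht0.le, ht1⟩
  have hpos {r : ℝ} (hr : 0 < r) (s : ℝ) (hs : s ∈ Set.Ioo (0 : ℝ) 1) :
      0 < jacobiIntegrand (1 / p) (1 / (p / (p - 1))) r k s :=
    jacobiIntegrand_pos hr hk0 hk1 hs.1.le hs.2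
  constructor
  · rw [hF, hF, ← sub_pos, ← integral_sub (hint hq ht) (hint hσ ht)]
    exact intervalIntegral_pos_of_pos_on ((hint hq ht).sub (hint hσ ht))
      (fun s hs => sub_pos.2
        (jacobiIntegrand_lt ha hb hq0 hqσ hk0 hk1 hs.1 (hs.2.trans_le ht1))) ht0
  · rw [hK, hK]
    rcases ht1.eq_or_lt with rfl | ht1'
    · have hKpos {r : ℝ} (hr : 1 < r) : 0 < Fpq p r k 1 := by
        rw [hF]
        exact intervalIntegral_pos_of_pos_on (hint hr hone)
          (hpos (zero_lt_one.trans hr)) zero_lt_one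
      rw [div_self (hKpos hq).ne', div_self (hKpos hσ).ne']
    · simp only [hF]
      exact integral_div_integral_le_of_mul_le ht0 ht1' (hint hq hone) (hint hσ hone)
        (hpos hq0) (hpos hσ0) fun u hu v hv huv =>
          jacobiIntegrand_mul_le ha.le hb hq0 hqσ.le hk0 hk1 hu.1.le huv hv.2
end

section
/- Let p, q ∈ (1,∞) and k ∈ [0,1). Then (i) p ↦ K_{pq}(k) is strictly decreasing on (1,∞) for fixed q and k; (ii) q ↦ K_{pq}(k) is strictly decreasing on (1,∞) for fixed p and k; (iii) k ↦ K_{pq}(k) is strictly increasing on [0,1) for fixed p and q. -/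
open Real intervalIntegral

lemma intervalIntegrable_Kpq {p q k : ℝ} (hp : 1 < p) (hq : 1 < q) (hk0 : 0 ≤ k) (hk1 : k < 1) :
    IntervalIntegrable (fun t : ℝ =>
      (1 - t ^ q) ^ (-(1 / p)) * (1 - k ^ q * t ^ q) ^ (-(1 / (p / (p - 1)))))
      MeasureTheory.volume 0 1 := by
  have hp0 : 0 < 1 / p := by positivity
  have hp1 : 1 / p < 1 := by rw [div_lt_one (by linarith)]; exact hp
  have hc : 0 < 1 / (p / (p - 1)) :=
    one_div_pos.2 (div_pos (by linarith) (by linarith))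
  have hkq : k ^ q < 1 := rpow_lt_one hk0 hk1 (by linarith)
  have hkq0 : 0 ≤ k ^ q := rpow_nonneg hk0 q
  have hdom : IntervalIntegrable (fun t : ℝ =>
      (1 - t) ^ (-(1 / p)) * (1 - k ^ q) ^ (-(1 / (p / (p - 1))))) MeasureTheory.volume 0 1 := by
    have h := (intervalIntegrable_rpow' (a := 1) (b := 0) (r := -(1 / p))
      (by linarith)).comp_sub_left 1
    simp only [sub_self, sub_zero] at h
    exact h.mul_const _
  refine hdom.mono_fun' (Measurable.aestronglyMeasurable (by fun_prop)) ?_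
  refine (MeasureTheory.ae_restrict_iff' measurableSet_uIoc).2 (.of_forall fun t ht => ?_)
  rw [Set.uIoc_of_le zero_le_one] at ht
  obtain ⟨ht0, ht1⟩ := ht
  have htq : t ^ q ≤ t := by
    simpa using rpow_le_rpow_of_exponent_ge ht0 ht1 hq.le
  have htq0 : 0 ≤ t ^ q := rpow_nonneg ht0.le q
  have hB : 1 - k ^ q ≤ 1 - k ^ q * t ^ q := by
    nlinarith
  have h1 : (1 - t ^ q) ^ (-(1 / p)) ≤ (1 - t) ^ (-(1 / p)) := by
    rcases ht1.eq_or_lt with rfl | ht1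
    · simp
    · exact rpow_le_rpow_of_nonpos (by linarith) (by linarith) (by linarith)
  have h2 : (1 - k ^ q * t ^ q) ^ (-(1 / (p / (p - 1)))) ≤
      (1 - k ^ q) ^ (-(1 / (p / (p - 1)))) :=
    rpow_le_rpow_of_nonpos (by linarith) hB (by linarith)
  have h3 : 0 ≤ (1 - t ^ q) ^ (-(1 / p)) := rpow_nonneg (by linarith) _
  have h4 : 0 ≤ (1 - k ^ q * t ^ q) ^ (-(1 / (p / (p - 1)))) := rpow_nonneg (by linarith) _
  refine (Real.norm_of_nonneg (mul_nonneg h3 h4)).trans_le ?_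
  exact mul_le_mul h1 h2 h4 (h3.trans h1)

lemma intervalIntegral_lt_of_forall_Ioo_lt {f g : ℝ → ℝ} {a b : ℝ} (hab : a < b)
    (hf : IntervalIntegrable f MeasureTheory.volume a b)
    (hg : IntervalIntegrable g MeasureTheory.volume a b)
    (h : ∀ x ∈ Set.Ioo a b, f x < g x) : ∫ x in a..b, f x < ∫ x in a..b, g x := by
  rw [← sub_pos, ← integral_sub hg hf]
  exact intervalIntegral_pos_of_pos_on (hg.sub hf) (fun x hx => sub_pos.2 (h x hx)) hab

lemma rpow_mul_rpow_conj_lt {A B p r : ℝ} (hA : 0 < A) (hAB : A < B) (hp : 1 < p) (hpr : p < r) :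
    A ^ (-(1 / r)) * B ^ (-(1 / (r / (r - 1)))) < A ^ (-(1 / p)) * B ^ (-(1 / (p / (p - 1)))) := by
  have hB := hA.trans hAB
  have key : ∀ s : ℝ, 1 < s →
      A ^ (-(1 / s)) * B ^ (-(1 / (s / (s - 1)))) = (B / A) ^ (1 / s) * B⁻¹ := by
    intro s hs
    have e : -(1 / (s / (s - 1))) = 1 / s + -1 := by
      have : s - 1 ≠ 0 := by linarith
      field_simp
      ring
    rw [e, rpow_add hB, rpow_neg_one, div_rpow hB.le hA.le, rpow_neg hA.le]
    ring
  rw [key p hp, key r (hp.trans hpr)]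
  exact mul_lt_mul_of_pos_right (rpow_lt_rpow_of_exponent_lt ((one_lt_div hA).2 hAB)
    (one_div_lt_one_div_of_lt (by linarith) hpr)) (inv_pos.2 hB)

theorem stmt10 (p q k : ℝ) (hp : 1 < p) (hq : 1 < q) (hk0 : 0 ≤ k) (hk1 : k < 1) :
    StrictAntiOn (fun p' => Kpq p' q k) (Set.Ioi (1:ℝ)) ∧
    StrictAntiOn (fun q' => Kpq p q' k) (Set.Ioi (1:ℝ)) ∧
    StrictMonoOn (fun k' => Kpq p q k') (Set.Ico (0:ℝ) 1) := by
  have hp0 : 0 < 1 / p := by positivity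
  have hc : 0 < 1 / (p / (p - 1)) :=
    one_div_pos.2 (div_pos (by linarith) (by linarith))
  refine ⟨fun a ha b hb hab => ?_, fun a ha b hb hab => ?_, fun a ha b hb hab => ?_⟩
  · rw [Set.mem_Ioi] at ha hb
    refine intervalIntegral_lt_of_forall_Ioo_lt one_pos (intervalIntegrable_Kpq hb hq hk0 hk1)
      (intervalIntegrable_Kpq ha hq hk0 hk1) fun t ht => ?_
    have htq : t ^ q < 1 := rpow_lt_one ht.1.le ht.2 (by linarith)
    have htq0 : 0 < t ^ q := rpow_pos_of_pos ht.1 q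
    have hkq : k ^ q < 1 := rpow_lt_one hk0 hk1 (by linarith)
    exact rpow_mul_rpow_conj_lt (by linarith) (by nlinarith) ha hab
  · rw [Set.mem_Ioi] at ha hb
    refine intervalIntegral_lt_of_forall_Ioo_lt one_pos (intervalIntegrable_Kpq hp hb hk0 hk1)
      (intervalIntegrable_Kpq hp ha hk0 hk1) fun t ht => ?_
    have hta : t ^ a < 1 := rpow_lt_one ht.1.le ht.2 (by linarith)
    have htb0 : 0 < t ^ b := rpow_pos_of_pos ht.1 b
    have htab : t ^ b < t ^ a := rpow_lt_rpow_of_exponent_gt ht.1 ht.2 hab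
    have hka : k ^ a < 1 := rpow_lt_one hk0 hk1 (by linarith)
    have hka0 : 0 ≤ k ^ a := rpow_nonneg hk0 a
    have hkab : k ^ b ≤ k ^ a :=
      rpow_le_rpow_of_exponent_ge_of_imp hk0 hk1.le hab.le fun _ h => by linarith
    have hprod : k ^ b * t ^ b ≤ k ^ a * t ^ a := mul_le_mul hkab htab.le htb0.le hka0
    have hlt : k ^ a * t ^ a < 1 := by nlinarith
    exact mul_lt_mul
      (rpow_lt_rpow_of_neg (by linarith) (by linarith) (by linarith))
      (rpow_le_rpow_of_nonpos (by linarith) (by linarith) (by linarith))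
      (rpow_pos_of_pos (by linarith) _) (rpow_nonneg (by linarith) _)
  · refine intervalIntegral_lt_of_forall_Ioo_lt one_pos
      (intervalIntegrable_Kpq hp hq ha.1 ha.2)
      (intervalIntegrable_Kpq hp hq hb.1 hb.2) fun t ht => ?_
    have htq : t ^ q < 1 := rpow_lt_one ht.1.le ht.2 (by linarith)
    have htq0 : 0 < t ^ q := rpow_pos_of_pos ht.1 q
    have hbq : b ^ q < 1 := rpow_lt_one hb.1 hb.2 (by linarith)
    have hab' : a ^ q < b ^ q := rpow_lt_rpow ha.1 hab (by linarith)
    have hprod : a ^ q * t ^ q < b ^ q * t ^ q := mul_lt_mul_of_pos_right hab' htq0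
    have hlt : b ^ q * t ^ q < 1 := by nlinarith
    exact mul_lt_mul_of_pos_left
      (rpow_lt_rpow_of_neg (by linarith) (by linarith) (by linarith))
      (rpow_pos_of_pos (by linarith) _)
end

section
/- Let p, q ∈ (1,∞), p' = p/(p−1), q' = q/(q−1), and k ∈ [0,1). Then K_{pq}(k) = (p'/q)·K_{q'p'}(k^{q/p'}); explicitly, ∫₀¹ (1−t^q)^{−1/p}·(1−k^q t^q)^{−1/p'} dt = (p'/q)·∫₀¹ (1−t^{p'})^{−1/q'}·(1−k^q t^{p'})^{−1/q} dt. -/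
open Real intervalIntegral

/-- The substitution `u = t ^ a` on the unit interval. -/
theorem integral_Ioo_comp_rpow {a : ℝ} (ha : 0 < a) (f : ℝ → ℝ) :
    ∫ t in Set.Ioo (0:ℝ) 1, f (t ^ a)
      = a⁻¹ * ∫ u in Set.Ioo (0:ℝ) 1, u ^ (a⁻¹ - 1) * f u := by
  have ha' : 0 < a⁻¹ := inv_pos.mpr ha
  have himg : (fun u : ℝ => u ^ a⁻¹) '' Set.Ioo 0 1 = Set.Ioo 0 1 := by
    ext t
    constructor
    · rintro ⟨u, hu, rfl⟩
      exact ⟨rpow_pos_of_pos hu.1 _, rpow_lt_one hu.1.le hu.2 ha'⟩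
    · intro ht
      exact ⟨t ^ a, ⟨rpow_pos_of_pos ht.1 _, rpow_lt_one ht.1.le ht.2 ha⟩,
        rpow_rpow_inv ht.1.le ha.ne'⟩
  have hsub := MeasureTheory.integral_image_eq_integral_abs_deriv_smul
    (s := Set.Ioo (0:ℝ) 1) (f := fun u : ℝ => u ^ a⁻¹) (f' := fun u => a⁻¹ * u ^ (a⁻¹ - 1))
    measurableSet_Ioo
    (fun u hu => (hasDerivAt_rpow_const (Or.inl hu.1.ne')).hasDerivWithinAt)
    (fun u hu v hv h => (rpow_left_inj hu.1.le hv.1.le ha'.ne').mp h)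
    (fun t => f (t ^ a))
  rw [himg] at hsub
  rw [hsub, ← MeasureTheory.integral_const_mul]
  refine MeasureTheory.setIntegral_congr_fun measurableSet_Ioo fun u hu => ?_
  have h : 0 < a⁻¹ * u ^ (a⁻¹ - 1) := mul_pos ha' (rpow_pos_of_pos hu.1 _)
  simp only [smul_eq_mul, abs_of_pos h, rpow_inv_rpow hu.1.le ha.ne', mul_assoc]

/-- The substitution `v = (1 - u) / (1 - m * u)` on the unit interval. -/
theorem integral_Ioo_comp_one_sub_div {m : ℝ} (hm : m < 1) (g : ℝ → ℝ) :
    ∫ v in Set.Ioo (0:ℝ) 1, g v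
      = ∫ u in Set.Ioo (0:ℝ) 1, (1 - m) / (1 - m * u) ^ 2 * g ((1 - u) / (1 - m * u)) := by
  have hpos : ∀ u ∈ Set.Ioo (0:ℝ) 1, 0 < 1 - m * u := fun u hu => by
    nlinarith [hu.1, hu.2, mul_pos hu.1 (sub_pos.mpr hm)]
  have hmaps : ∀ u ∈ Set.Ioo (0:ℝ) 1, (1 - u) / (1 - m * u) ∈ Set.Ioo (0:ℝ) 1 := fun u hu =>
    ⟨div_pos (sub_pos.mpr hu.2) (hpos u hu), by
      rw [div_lt_one (hpos u hu)]
      nlinarith [mul_pos hu.1 (sub_pos.mpr hm)]⟩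
  have hinv : ∀ u ∈ Set.Ioo (0:ℝ) 1,
      (1 - (1 - u) / (1 - m * u)) / (1 - m * ((1 - u) / (1 - m * u))) = u := fun u hu => by
    have h1 := (hpos u hu).ne'
    have h2 := (hpos _ (hmaps u hu)).ne'
    rw [div_eq_iff h2]
    linear_combination -div_mul_cancel₀ (1 - u) h1
  have himg : (fun u : ℝ => (1 - u) / (1 - m * u)) '' Set.Ioo 0 1 = Set.Ioo 0 1 := by
    ext v
    constructor
    · rintro ⟨u, hu, rfl⟩
      exact hmaps u hu
    · intro hv
      exact ⟨_, hmaps v hv, hinv v hv⟩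
  have hderiv : ∀ u ∈ Set.Ioo (0:ℝ) 1, HasDerivWithinAt (fun u : ℝ => (1 - u) / (1 - m * u))
      (-((1 - m) / (1 - m * u) ^ 2)) (Set.Ioo 0 1) u := fun u hu => by
    have h1 : HasDerivAt (fun u : ℝ => 1 - u) (-1) u := (hasDerivAt_id u).const_sub 1
    have h2 : HasDerivAt (fun u : ℝ => 1 - m * u) (-(m * 1)) u :=
      ((hasDerivAt_id u).const_mul m).const_sub 1
    refine ((h1.div h2 (hpos u hu).ne').congr_deriv ?_).hasDerivWithinAt
    rw [← neg_div]
    ring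
  have hsub := MeasureTheory.integral_image_eq_integral_abs_deriv_smul
    measurableSet_Ioo hderiv (Set.LeftInvOn.injOn (f₁' := fun u => (1 - u) / (1 - m * u)) hinv) g
  rw [himg] at hsub
  rw [hsub]
  refine MeasureTheory.setIntegral_congr_fun measurableSet_Ioo fun u hu => ?_
  have h : 0 < (1 - m) / (1 - m * u) ^ 2 :=
    div_pos (sub_pos.mpr hm) (pow_pos (hpos u hu) 2)
  simp only [smul_eq_mul, abs_neg, abs_of_pos h]

/-- The symmetry of Euler's integral for the hypergeometric function under
`u ↦ (1 - u) / (1 - m * u)`. -/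
theorem integral_Ioo_rpow_mul_one_sub_rpow_symm {m : ℝ} (hm : m < 1) (a b : ℝ) :
    ∫ v in Set.Ioo (0:ℝ) 1, v ^ (b - 1) * ((1 - v) ^ (a - 1) * (1 - m * v) ^ (-a))
      = ∫ u in Set.Ioo (0:ℝ) 1, u ^ (a - 1) * ((1 - u) ^ (b - 1) * (1 - m * u) ^ (-b)) := by
  rw [integral_Ioo_comp_one_sub_div hm]
  refine MeasureTheory.setIntegral_congr_fun measurableSet_Ioo fun u hu => ?_
  have hd : 0 < 1 - m * u := by nlinarith [hu.1, hu.2, mul_pos hu.1 (sub_pos.mpr hm)]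
  have hm' : 0 < 1 - m := sub_pos.mpr hm
  have hu' : 0 < 1 - u := sub_pos.mpr hu.2
  have e1 : 1 - (1 - u) / (1 - m * u) = u * (1 - m) / (1 - m * u) := by
    rw [eq_div_iff hd.ne', sub_mul, div_mul_cancel₀ _ hd.ne']
    ring
  have e2 : 1 - m * ((1 - u) / (1 - m * u)) = (1 - m) / (1 - m * u) := by
    field_simp
    ring
  simp only [e1, e2]
  rw [div_rpow hu'.le hd.le, div_rpow (mul_pos hu.1 hm').le hd.le, div_rpow hm'.le hd.le,
    mul_rpow hu.1.le hm'.le, rpow_sub hd, rpow_sub hd, rpow_sub hm', rpow_neg hm'.le,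
    rpow_neg hd.le, rpow_neg hd.le, rpow_one, rpow_one]
  have h1 := rpow_pos_of_pos hd a
  have h2 := rpow_pos_of_pos hd b
  have h3 := rpow_pos_of_pos hm' a
  field_simp

theorem stmt12 (p q k : ℝ) (hp : 1 < p) (hq : 1 < q) (hk0 : 0 ≤ k) (hk1 : k < 1) :
    (∫ t in (0:ℝ)..1,
        (1 - t ^ q) ^ (-(1 / p)) * (1 - k ^ q * t ^ q) ^ (-(1 / (p / (p - 1)))))
      = (p / (p - 1)) / q *
        ∫ t in (0:ℝ)..1,
          (1 - t ^ (p / (p - 1))) ^ (-(1 / (q / (q - 1)))) *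
            (1 - k ^ q * t ^ (p / (p - 1))) ^ (-(1 / q)) := by
  have hq0 : 0 < q := by linarith
  have hp' : 0 < p / (p - 1) := div_pos (by linarith) (by linarith)
  have hm : k ^ q < 1 := rpow_lt_one hk0 hk1 hq0
  have ep : -(1 / p) = (p / (p - 1))⁻¹ - 1 := by
    field_simp
    ring
  have eq : -(1 / (q / (q - 1))) = q⁻¹ - 1 := by
    field_simp
    ring
  rw [ep, eq, one_div, one_div]
  simp only [integral_of_le zero_le_one, MeasureTheory.integral_Ioc_eq_integral_Ioo]
  rw [integral_Ioo_comp_rpow hq0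
      (fun u => (1 - u) ^ ((p / (p - 1))⁻¹ - 1) * (1 - k ^ q * u) ^ (-(p / (p - 1))⁻¹)),
    integral_Ioo_comp_rpow hp' (fun u => (1 - u) ^ (q⁻¹ - 1) * (1 - k ^ q * u) ^ (-q⁻¹)),
    integral_Ioo_rpow_mul_one_sub_rpow_symm hm, ← mul_assoc]
  congr 1
  rw [div_mul_eq_mul_div, mul_inv_cancel₀ hp'.ne', one_div]
end

section
/- Let r ∈ (1,∞) and k ∈ (0,1). Then ∫₀¹ (1 − k^r + k^r t^r)^{−1/r} dt = (1/k)·∫₀^k (1 − s^r)^{−1} ds. -/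
open Real intervalIntegral

/-- The derivative of `t ↦ t (1 - c + c tʳ)^(-1/r)`. -/
lemma hasDerivAt_mul_rpow_affine_rpow {r c t : ℝ} (hr : r ≠ 0) (ht : 0 < t)
    (hD : 0 < 1 - c + c * t ^ r) :
    HasDerivAt (fun t : ℝ => t * (1 - c + c * t ^ r) ^ (-(1 / r)))
      ((1 - c) * (1 - c + c * t ^ r) ^ (-(1 / r) - 1)) t := by
  have hpow : HasDerivAt (fun t : ℝ => 1 - c + c * t ^ r) (c * (r * t ^ (r - 1))) t :=
    ((hasDerivAt_rpow_const (Or.inl ht.ne')).const_mul c).const_add (1 - c)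
  refine ((hasDerivAt_id t).mul (hpow.rpow_const (Or.inl hD.ne'))).congr_deriv ?_
  have hD' : (1 - c + c * t ^ r) ^ (-(1 / r))
      = (1 - c + c * t ^ r) ^ (-(1 / r) - 1) * (1 - c + c * t ^ r) := by
    rw [rpow_sub_one hD.ne', div_mul_cancel₀ _ hD.ne']
  have ht' : t ^ r = t ^ (r - 1) * t := by
    rw [rpow_sub_one ht.ne', div_mul_cancel₀ _ ht.ne']
  rw [hD']
  generalize (1 - c + c * t ^ r) ^ (-(1 / r) - 1) = E
  rw [ht', id]
  field_simp
  ring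

/-- The substitution `s = k t (1 - kʳ + kʳ tʳ)^(-1/r)` scales `1 - sʳ` to `(1 - kʳ) / D`. -/
lemma one_sub_mul_rpow_affine_rpow {r k t : ℝ} (hr : r ≠ 0) (hk : 0 ≤ k) (ht : 0 ≤ t)
    (hD : 0 < 1 - k ^ r + k ^ r * t ^ r) :
    1 - (k * (t * (1 - k ^ r + k ^ r * t ^ r) ^ (-(1 / r)))) ^ r
      = (1 - k ^ r) / (1 - k ^ r + k ^ r * t ^ r) := by
  rw [mul_rpow hk (by positivity), mul_rpow ht (by positivity), ← rpow_mul hD.le,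
    show -(1 / r) * r = -1 by field_simp, rpow_neg_one]
  field_simp
  ring

theorem stmt15 (r k : ℝ) (hr : 1 < r) (hk0 : 0 < k) (hk1 : k < 1) :
    (∫ t in (0:ℝ)..1, (1 - k ^ r + k ^ r * t ^ r) ^ (-(1 / r)))
      = (1 / k) * ∫ s in (0:ℝ)..k, (1 - s ^ r)⁻¹ := by
  have hr0 : 0 < r := by linarith
  have hc : 0 < 1 - k ^ r := sub_pos.2 (rpow_lt_one hk0.le hk1 hr0)
  have hD : ∀ t : ℝ, 0 ≤ t → 0 < 1 - k ^ r + k ^ r * t ^ r := fun t ht => by positivity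
  have hsubst := integral_comp_mul_deriv_of_deriv_nonneg (a := 0) (b := 1)
    (f := fun t : ℝ => k * (t * (1 - k ^ r + k ^ r * t ^ r) ^ (-(1 / r))))
    (f' := fun t : ℝ => k * ((1 - k ^ r) * (1 - k ^ r + k ^ r * t ^ r) ^ (-(1 / r) - 1)))
    (g := fun s : ℝ => (1 - s ^ r)⁻¹) ?_ ?_ ?_
  · simp only [zero_mul, mul_zero, one_rpow, mul_one, sub_add_cancel] at hsubst
    rw [← hsubst, ← integral_const_mul]
    refine integral_congr fun t ht => ?_
    rw [Set.uIcc_of_le zero_le_one] at ht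
    have hDt := hD t ht.1
    simp only [Function.comp_apply]
    rw [one_sub_mul_rpow_affine_rpow hr0.ne' hk0.le ht.1 hDt, rpow_sub_one hDt.ne']
    field_simp
  · rw [Set.uIcc_of_le zero_le_one]
    refine continuousOn_const.mul (continuousOn_id.mul (ContinuousOn.rpow_const ?_ ?_))
    · exact (continuous_const.add
        (continuous_const.mul (continuous_id.rpow_const fun _ => Or.inr hr0.le))).continuousOn
    · exact fun t ht => Or.inl (hD t ht.1).ne'
  · intro t ht
    rw [min_eq_left zero_le_one] at ht
    exact (hasDerivAt_mul_rpow_affine_rpow hr0.ne' ht.1 (hD t ht.1.le)).const_mul k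
  · intro t ht
    rw [min_eq_left zero_le_one] at ht
    have hDt := hD t ht.1.le
    positivity
end

section
/- For r ∈ (1,∞) let π_{r'r} = 2∫₀¹ (1−t^r)^{(1/r)−1} dt. Then (i) π_{r'r} = (2/r)·B(1/r, 1/r); (ii) r ↦ π_{r'r} is strictly increasing on (1,∞); (iii) π_{r'r} → 2 as r → 1⁺ and π_{r'r} → 4 as r → +∞. -/
open Real Filter Topology intervalIntegral

/-- `π_{r'r} = 2∫₀¹ (1−t^r)^{(1/r)−1} dt`. -/
noncomputable def piRR (r : ℝ) : ℝ := 2 * ∫ t in (0:ℝ)..1, (1 - t ^ r) ^ (1 / r - 1)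

theorem strictConvexOn_log_Gamma :
    StrictConvexOn ℝ (Set.Ioi (0 : ℝ)) (fun x => Real.log (Real.Gamma x)) := by
  have hconv : ConvexOn ℝ (Set.Ioi (0 : ℝ)) (fun x => Real.log (Real.Gamma (x + 1))) :=
    (Real.convexOn_log_Gamma.translate_left 1).subset
      (fun x (hx : 0 < x) => show (0 : ℝ) < 1 + x by linarith) (convex_Ioi 0)
  refine (hconv.add_strictConvexOn strictConcaveOn_log_Ioi.neg).congr fun x (hx : 0 < x) => ?_
  simp only [Pi.add_apply, Pi.neg_apply]
  rw [Real.Gamma_add_one hx.ne', Real.log_mul hx.ne' (Real.Gamma_pos_of_pos hx).ne']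
  ring

theorem strictAntiOn_Gamma_sq_div_Gamma :
    StrictAntiOn (fun a : ℝ => Real.Gamma (1 + a) ^ 2 / Real.Gamma (1 + 2 * a)) (Set.Ioi 0) := by
  intro a (ha : 0 < a) b (hb : 0 < b) hab
  have hpos : ∀ {x : ℝ}, 0 < x → 0 < Real.Gamma x := Real.Gamma_pos_of_pos
  have mem : ∀ {x : ℝ}, 0 < x → 1 + x ∈ Set.Ioi (0 : ℝ) := fun hx =>
    show (0 : ℝ) < _ by linarith
  have h2a : 0 < 2 * a := by linarith
  have h2b : 0 < 2 * b := by linarith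
  have h₁ := strictConvexOn_log_Gamma.secant_strict_mono (mem ha) (mem hb) (mem h2b)
    (by linarith) (by linarith) (by linarith)
  have h₂ := strictConvexOn_log_Gamma.secant_strict_mono (mem h2b) (mem ha) (mem h2a)
    (by linarith) (by linarith) (by linarith)
  rw [← neg_div_neg_eq, neg_sub, neg_sub] at h₂
  have h := h₁.trans (h₂.trans_eq (by rw [← neg_div_neg_eq, neg_sub, neg_sub]))
  rw [show 1 + b - (1 + a) = b - a by ring, show 1 + 2 * b - (1 + 2 * a) = (b - a) * 2 by ring,
    ← div_div, div_right_comm, div_lt_div_iff_of_pos_right (sub_pos.2 hab)] at h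
  have hG : ∀ x : ℝ, 0 < x → 0 < Real.Gamma (1 + x) := fun x hx => hpos (mem hx)
  have hlog : ∀ x : ℝ, 0 < x → Real.log (Real.Gamma (1 + x) ^ 2 / Real.Gamma (1 + 2 * x)) =
      2 * Real.log (Real.Gamma (1 + x)) - Real.log (Real.Gamma (1 + 2 * x)) := fun x hx => by
    rw [Real.log_div (pow_pos (hG x hx) 2).ne' (hG (2 * x) (by linarith)).ne', Real.log_pow]
    norm_num
  refine (Real.log_lt_log_iff (div_pos (pow_pos (hG b hb) 2) (hG _ h2b))
    (div_pos (pow_pos (hG a ha) 2) (hG _ h2a))).1 ?_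
  rw [hlog a ha, hlog b hb]
  linarith

theorem BetaFn_eq_beta {x y : ℝ} (hx : 0 < x) (hy : 0 < y) :
    BetaFn x y = ProbabilityTheory.beta x y := by
  rw [ProbabilityTheory.beta_eq_betaIntegralReal x y hx hy]
  have h : Complex.betaIntegral x y = (BetaFn x y : ℂ) := by
    rw [Complex.betaIntegral, BetaFn, ← intervalIntegral.integral_ofReal]
    refine intervalIntegral.integral_congr fun t ht => ?_
    rw [Set.uIcc_of_le zero_le_one] at ht
    rw [Complex.ofReal_mul, Complex.ofReal_cpow ht.1, Complex.ofReal_cpow (sub_nonneg.2 ht.2)]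
    push_cast
    rfl
  rw [h, Complex.ofReal_re]

theorem image_rpow_Ioo {r : ℝ} (hr : 0 < r) :
    (fun t : ℝ => t ^ r) '' Set.Ioo 0 1 = Set.Ioo 0 1 := by
  ext u
  constructor
  · rintro ⟨t, ht, rfl⟩
    exact ⟨Real.rpow_pos_of_pos ht.1 r, Real.rpow_lt_one ht.1.le ht.2 hr⟩
  · intro hu
    exact ⟨u ^ r⁻¹, ⟨Real.rpow_pos_of_pos hu.1 _, Real.rpow_lt_one hu.1.le hu.2 (inv_pos.2 hr)⟩,
      Real.rpow_inv_rpow hu.1.le hr.ne'⟩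

theorem BetaFn_one_div_left {r : ℝ} (hr : 0 < r) (y : ℝ) :
    BetaFn (1 / r) y = r * ∫ t in (0 : ℝ)..1, (1 - t ^ r) ^ (y - 1) := by
  have hderiv : ∀ t ∈ Set.Ioo (0 : ℝ) 1,
      HasDerivWithinAt (fun t : ℝ => t ^ r) (r * t ^ (r - 1)) (Set.Ioo 0 1) t := fun t ht =>
    (Real.hasDerivAt_rpow_const (Or.inl ht.1.ne')).hasDerivWithinAt
  have hinj : Set.InjOn (fun t : ℝ => t ^ r) (Set.Ioo 0 1) := fun s hs t ht h =>
    (Real.rpow_left_inj hs.1.le ht.1.le hr.ne').1 h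
  have h := MeasureTheory.integral_image_eq_integral_abs_deriv_smul measurableSet_Ioo hderiv hinj
    (fun u => u ^ (1 / r - 1) * (1 - u) ^ (y - 1))
  rw [image_rpow_Ioo hr] at h
  rw [BetaFn, integral_of_le zero_le_one, integral_of_le zero_le_one,
    MeasureTheory.integral_Ioc_eq_integral_Ioo, MeasureTheory.integral_Ioc_eq_integral_Ioo, h,
    ← MeasureTheory.integral_const_mul]
  refine MeasureTheory.setIntegral_congr_fun measurableSet_Ioo fun t ht => ?_
  have hpow : t ^ (r - 1) * (t ^ r) ^ (1 / r - 1) = 1 := by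
    rw [← Real.rpow_mul ht.1.le, ← Real.rpow_add ht.1,
      show r - 1 + r * (1 / r - 1) = 0 by field_simp; ring, Real.rpow_zero]
  simp only [smul_eq_mul]
  rw [abs_of_nonneg (mul_nonneg hr.le (Real.rpow_nonneg ht.1.le _))]
  linear_combination r * (1 - t ^ r) ^ (y - 1) * hpow

theorem piRR_eq_BetaFn {r : ℝ} (hr : 0 < r) : piRR r = 2 / r * BetaFn (1 / r) (1 / r) := by
  rw [BetaFn_one_div_left hr, piRR]
  field_simp

theorem piRR_eq_Gamma {r : ℝ} (hr : 0 < r) :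
    piRR r = 4 * (Real.Gamma (1 + r⁻¹) ^ 2 / Real.Gamma (1 + 2 * r⁻¹)) := by
  have ha : 0 < r⁻¹ := inv_pos.2 hr
  have h2a : 0 < 2 * r⁻¹ := by linarith
  have hG := (Real.Gamma_pos_of_pos h2a).ne'
  rw [piRR_eq_BetaFn hr, one_div, BetaFn_eq_beta ha ha, ProbabilityTheory.beta, ← two_mul,
    add_comm 1, add_comm 1, Real.Gamma_add_one ha.ne', Real.Gamma_add_one h2a.ne']
  field_simp
  ring

theorem tendsto_piRR {l : Filter ℝ} {a : ℝ} (ha : 0 ≤ a) (hl : ∀ᶠ r in l, 0 < r)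
    (hinv : Tendsto (fun r : ℝ => r⁻¹) l (𝓝 a)) :
    Tendsto piRR l (𝓝 (4 * (Real.Gamma (1 + a) ^ 2 / Real.Gamma (1 + 2 * a)))) := by
  have hcont : ∀ x : ℝ, 0 < x → ContinuousAt Real.Gamma x := fun x hx =>
    (Real.differentiableAt_Gamma fun m => by
      have : (0 : ℝ) ≤ m := m.cast_nonneg
      linarith).continuousAt
  have h₁ := (hcont (1 + a) (by linarith)).tendsto.comp (hinv.const_add 1)
  have h₂ := (hcont (1 + 2 * a) (by linarith)).tendsto.comp ((hinv.const_mul 2).const_add 1)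
  refine (((h₁.pow 2).div h₂ (Real.Gamma_pos_of_pos (by linarith)).ne').const_mul 4).congr' ?_
  filter_upwards [hl] with r hr
  exact (piRR_eq_Gamma hr).symm

theorem stmt16 :
    (∀ r : ℝ, 1 < r → piRR r = 2 / r * BetaFn (1 / r) (1 / r)) ∧
    StrictMonoOn piRR (Set.Ioi (1:ℝ)) ∧
    Tendsto piRR (𝓝[>] 1) (𝓝 2) ∧
    Tendsto piRR atTop (𝓝 4) := by
  refine ⟨fun r hr => piRR_eq_BetaFn (by linarith), ?_, ?_, ?_⟩
  · intro r (hr : 1 < r) s (hs : 1 < s) hrs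
    have hr₀ : 0 < r := by linarith
    have hs₀ : 0 < s := by linarith
    rw [piRR_eq_Gamma hr₀, piRR_eq_Gamma hs₀]
    exact mul_lt_mul_of_pos_left (strictAntiOn_Gamma_sq_div_Gamma (inv_pos.2 hs₀) (inv_pos.2 hr₀)
      (inv_strictAnti₀ hr₀ hrs)) four_pos
  · have h := tendsto_piRR (l := 𝓝[>] 1) zero_le_one
      (eventually_mem_nhdsWithin.mono fun r (hr : 1 < r) => by linarith)
      (by simpa using (tendsto_inv₀ (one_ne_zero (α := ℝ))).mono_left nhdsWithin_le_nhds)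
    convert h using 2
    have h₃ : Real.Gamma (1 + 2 * 1) = 2 := by
      rw [show (1 + 2 * 1 : ℝ) = (2 : ℕ) + 1 by norm_num, Real.Gamma_nat_eq_factorial]
      norm_num
    rw [h₃, one_add_one_eq_two, Real.Gamma_two]
    norm_num
  · simpa using tendsto_piRR le_rfl (eventually_gt_atTop 0) tendsto_inv_atTop_zero
end

section
/- The function t ↦ t·B(t,t) is strictly decreasing on (0,∞); it tends to 2 as t → 0⁺, equals 1 at t = 1, and in particular t·B(t,t) ≤ 2 for every t ∈ (0,∞). -/
open Real Filter Topology intervalIntegral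

theorem betaFn_eq_Gamma_mul_div {x y : ℝ} (hx : 0 < x) (hy : 0 < y) :
    BetaFn x y = Real.Gamma x * Real.Gamma y / Real.Gamma (x + y) := by
  have h : Complex.betaIntegral x y = (BetaFn x y : ℂ) := by
    rw [Complex.betaIntegral, BetaFn, ← intervalIntegral.integral_ofReal]
    refine intervalIntegral.integral_congr fun t ht => ?_
    rw [Set.uIcc_of_le zero_le_one] at ht
    have h1 : (0 : ℝ) ≤ 1 - t := by linarith [ht.2]
    push_cast [Complex.ofReal_cpow ht.1, Complex.ofReal_cpow h1]
    rfl
  have hb := ProbabilityTheory.beta_eq_betaIntegralReal x y hx hy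
  rw [h, Complex.ofReal_re] at hb
  exact hb.symm

theorem mul_betaFn_self {t : ℝ} (ht : 0 < t) :
    t * BetaFn t t = 2 * (Real.Gamma (1 + t) ^ 2 / Real.Gamma (1 + 2 * t)) := by
  have h1 : Real.Gamma (1 + t) = t * Real.Gamma t := by
    rw [add_comm, Real.Gamma_add_one ht.ne']
  have h2 : Real.Gamma (1 + 2 * t) = 2 * t * Real.Gamma (2 * t) := by
    rw [add_comm, Real.Gamma_add_one (by positivity)]
  have h3 := (Real.Gamma_pos_of_pos (show 0 < 2 * t by positivity)).ne'
  rw [betaFn_eq_Gamma_mul_div ht ht, h1, h2, ← two_mul]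
  field_simp

/-- `Γ(a + t)² / Γ(a + 2t)` is non-increasing in `t ≥ 0`, by monotonicity of the secant slopes of
`log Γ`. -/
theorem antitoneOn_Gamma_sq_div {a : ℝ} (ha : 0 < a) :
    AntitoneOn (fun t => Real.Gamma (a + t) ^ 2 / Real.Gamma (a + 2 * t)) (Set.Ici 0) := by
  intro s hs t ht hst
  rw [Set.mem_Ici] at hs ht
  rcases hst.eq_or_lt with rfl | hlt
  · rfl
  have hc := Real.convexOn_log_Gamma
  have m1 : 0 < a + s := by positivity
  have m2 : 0 < a + t := by positivity
  have m3 : 0 < a + 2 * s := by positivity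
  have m4 : 0 < a + 2 * t := by positivity
  have e1 := hc.secant_mono (a := a + s) (x := a + t) (y := a + 2 * t) m1 m2 m4
    (by linarith) (by linarith) (by linarith)
  have e2 := hc.secant_mono (a := a + 2 * t) (x := a + s) (y := a + 2 * s) m4 m1 m3
    (by linarith) (by linarith) (by linarith)
  rw [← neg_div_neg_eq, neg_sub, neg_sub] at e2
  have e3 := e1.trans e2
  rw [← neg_div_neg_eq (_ - _) (a + 2 * s - (a + 2 * t)), neg_sub, neg_sub,
    div_le_div_iff₀ (by linarith) (by linarith)] at e3
  simp only [Function.comp_apply] at e3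
  have g1 := Real.Gamma_pos_of_pos m1
  have g2 := Real.Gamma_pos_of_pos m2
  have g3 := Real.Gamma_pos_of_pos m3
  have g4 := Real.Gamma_pos_of_pos m4
  have e4 : 2 * (Real.log (Real.Gamma (a + t)) - Real.log (Real.Gamma (a + s))) ≤
      Real.log (Real.Gamma (a + 2 * t)) - Real.log (Real.Gamma (a + 2 * s)) := by
    refine le_of_mul_le_mul_right ?_ (sub_pos.2 hlt)
    linarith
  rw [← Real.log_le_log_iff (by positivity) (by positivity),
    Real.log_div (by positivity) g4.ne', Real.log_div (by positivity) g3.ne',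
    Real.log_pow, Real.log_pow]
  push_cast
  linarith

theorem strictAntiOn_Gamma_sq_div :
    StrictAntiOn (fun t => 2 * (Real.Gamma (1 + t) ^ 2 / Real.Gamma (1 + 2 * t)))
      (Set.Ici 0) := by
  have key : ∀ t : ℝ, 0 ≤ t → Real.Gamma (1 + t) ^ 2 / Real.Gamma (1 + 2 * t) =
      Real.Gamma (2 + t) ^ 2 / Real.Gamma (2 + 2 * t) * (1 - (1 - 1 / (1 + t)) ^ 2) := by
    intro t ht
    have h1 : Real.Gamma (2 + t) = (1 + t) * Real.Gamma (1 + t) := by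
      rw [← Real.Gamma_add_one (by positivity)]; ring_nf
    have h2 : Real.Gamma (2 + 2 * t) = (1 + 2 * t) * Real.Gamma (1 + 2 * t) := by
      rw [← Real.Gamma_add_one (by positivity)]; ring_nf
    have h3 := (Real.Gamma_pos_of_pos (show 0 < 1 + 2 * t by positivity)).ne'
    have h4 : 1 + t ≠ 0 := by positivity
    have h5 : 1 + 2 * t ≠ 0 := by positivity
    rw [h1, h2]
    field_simp
    ring
  intro s hs t ht hst
  have hanti := antitoneOn_Gamma_sq_div two_pos hs ht hst.le
  rw [Set.mem_Ici] at hs ht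
  have hdec : 1 - (1 - 1 / (1 + t)) ^ 2 < 1 - (1 - 1 / (1 + s)) ^ 2 := by
    have h1 : 1 / (1 + t) < 1 / (1 + s) := by gcongr
    have h2 : 1 / (1 + s) ≤ 1 := by rw [div_le_one (by positivity)]; linarith
    gcongr
  have hnonneg : 0 ≤ 1 - (1 - 1 / (1 + t)) ^ 2 := by
    have h1 : 0 ≤ 1 / (1 + t) := by positivity
    have h2 : 1 / (1 + t) ≤ 1 := by rw [div_le_one (by positivity)]; linarith
    nlinarith
  have hpos : 0 < Real.Gamma (2 + s) ^ 2 / Real.Gamma (2 + 2 * s) := by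
    have h1 := Real.Gamma_pos_of_pos (show 0 < 2 + s by positivity)
    have h2 := Real.Gamma_pos_of_pos (show 0 < 2 + 2 * s by positivity)
    positivity
  simp only [key s hs, key t ht]
  exact mul_lt_mul_of_pos_left (mul_lt_mul' hanti hdec hnonneg hpos) two_pos

theorem tendsto_Gamma_sq_div :
    Tendsto (fun t => 2 * (Real.Gamma (1 + t) ^ 2 / Real.Gamma (1 + 2 * t))) (𝓝 0) (𝓝 2) := by
  have hG : ContinuousAt Real.Gamma 1 :=
    (Real.differentiableOn_Gamma_Ioi.differentiableAt (Ioi_mem_nhds one_pos)).continuousAt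
  have h1 : Tendsto (fun t : ℝ => 1 + t) (𝓝 0) (𝓝 1) :=
    Continuous.tendsto' (by fun_prop) _ _ (by simp)
  have h2 : Tendsto (fun t : ℝ => 1 + 2 * t) (𝓝 0) (𝓝 1) :=
    Continuous.tendsto' (by fun_prop) _ _ (by simp)
  have h := (((hG.tendsto.comp h1).pow 2).div (hG.tendsto.comp h2) (by simp)).const_mul 2
  simpa using h

theorem stmt17 :
    StrictAntiOn (fun t => t * BetaFn t t) (Set.Ioi (0:ℝ)) ∧
    Tendsto (fun t => t * BetaFn t t) (𝓝[>] 0) (𝓝 2) ∧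
    (1 : ℝ) * BetaFn 1 1 = 1 ∧
    (∀ t : ℝ, 0 < t → t * BetaFn t t ≤ 2) := by
  refine ⟨?_, ?_, ?_, fun t ht => ?_⟩
  · exact (strictAntiOn_Gamma_sq_div.mono Set.Ioi_subset_Ici_self).congr
      fun t ht => (mul_betaFn_self ht).symm
  · refine (tendsto_Gamma_sq_div.mono_left nhdsWithin_le_nhds).congr' ?_
    filter_upwards [self_mem_nhdsWithin] with t ht using (mul_betaFn_self ht).symm
  · simp [BetaFn]
  · have h := strictAntiOn_Gamma_sq_div Set.self_mem_Ici (Set.mem_Ici.2 ht.le) ht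
    rw [mul_betaFn_self ht]
    simpa using h.le
end

section
/- Let p, q ∈ (1,∞) and k ∈ [0,1), and let s denote the inverse of F_{pq,k}, i.e., the strictly increasing bijection s : [0, K_{pq}(k)] → [0,1] with F_{pq,k}(s(x)) = x. Then 4·∫₀^{1/2} s(2K_{pq}(k)·x)·sin(πx) dx ≥ 8/π². -/
open Real intervalIntegral

/-- If `f` is monotone on `[0, 1)` and integrable on `[0, 1]`, its primitive lies below the chord. -/
theorem integral_le_mul_integral_of_monotoneOn {f : ℝ → ℝ} (hf : MonotoneOn f (Set.Ico 0 1))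
    (hfi : IntervalIntegrable f MeasureTheory.volume 0 1) {y : ℝ} (hy : y ∈ Set.Icc (0:ℝ) 1) :
    ∫ t in (0:ℝ)..y, f t ≤ y * ∫ t in (0:ℝ)..1, f t := by
  obtain ⟨h0, h1⟩ := hy
  rcases h1.eq_or_lt with rfl | h1
  · simp
  have hi0 : IntervalIntegrable f MeasureTheory.volume 0 y :=
    hfi.mono_set (by
      rw [Set.uIcc_of_le h0, Set.uIcc_of_le zero_le_one]; exact Set.Icc_subset_Icc le_rfl h1.le)
  have hi1 : IntervalIntegrable f MeasureTheory.volume y 1 :=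
    hfi.mono_set (by
      rw [Set.uIcc_of_le h1.le, Set.uIcc_of_le zero_le_one]; exact Set.Icc_subset_Icc h0 le_rfl)
  have hA : ∫ t in (0:ℝ)..y, f t ≤ y * f y := by
    have := integral_mono_on_of_le_Ioo h0 hi0 (intervalIntegrable_const (c := f y))
      fun t ht => hf ⟨ht.1.le, ht.2.trans h1⟩ ⟨h0, h1⟩ ht.2.le
    simpa using this
  have hB : (1 - y) * f y ≤ ∫ t in y..1, f t := by
    have := integral_mono_on_of_le_Ioo h1.le (intervalIntegrable_const (c := f y)) hi1
      fun t ht => hf ⟨h0, h1⟩ ⟨h0.trans ht.1.le, ht.2⟩ ht.1.le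
    simpa using this
  rw [← integral_add_adjacent_intervals hi0 hi1]
  nlinarith [mul_le_mul_of_nonneg_left hB h0, mul_le_mul_of_nonneg_left hA (sub_nonneg.2 h1.le)]

theorem monotoneOn_Fpq_integrand {p q k : ℝ} (hp : 1 < p) (hq : 1 < q) (hk0 : 0 ≤ k)
    (hk1 : k < 1) :
    MonotoneOn (fun t : ℝ => (1 - t ^ q) ^ (-(1 / p)) *
      (1 - k ^ q * t ^ q) ^ (-(1 / (p / (p - 1))))) (Set.Ico 0 1) := by
  have hq0 : 0 < q := by linarith
  have hpp : 0 ≤ 1 / (p / (p - 1)) := by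
    have : 0 < p - 1 := by linarith
    positivity
  rintro a ⟨ha0, -⟩ b ⟨hb0, hb1⟩ hab
  have hb : b ^ q < 1 := Real.rpow_lt_one hb0 hb1 hq0
  have hab' : a ^ q ≤ b ^ q := Real.rpow_le_rpow ha0 hab hq0.le
  have hkq0 : 0 ≤ k ^ q := Real.rpow_nonneg hk0 q
  have hkq1 : k ^ q < 1 := Real.rpow_lt_one hk0 hk1 hq0
  have hbq0 : 0 ≤ b ^ q := Real.rpow_nonneg hb0 q
  have hkb : k ^ q * b ^ q < 1 := by nlinarith
  have hkab : k ^ q * a ^ q ≤ k ^ q * b ^ q := mul_le_mul_of_nonneg_left hab' hkq0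
  apply mul_le_mul
  · exact Real.rpow_le_rpow_of_nonpos (by linarith) (by linarith)
      (by rw [neg_nonpos]; positivity)
  · exact Real.rpow_le_rpow_of_nonpos (by linarith) (by linarith) (neg_nonpos.2 hpp)
  · exact Real.rpow_nonneg (by linarith) _
  · exact Real.rpow_nonneg (by linarith) _

theorem integral_two_mul_mul_sin_pi_mul :
    ∫ x in (0:ℝ)..(1/2), 2 * x * Real.sin (π * x) = 2 / π ^ 2 := by
  have hπ : π ≠ 0 := Real.pi_ne_zero
  have hd : ∀ x ∈ Set.uIcc (0:ℝ) (1/2), HasDerivAt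
      (fun x => 2 / π ^ 2 * Real.sin (π * x) - 2 / π * (x * Real.cos (π * x)))
      (2 * x * Real.sin (π * x)) x := by
    intro x _
    have hl : HasDerivAt (fun x : ℝ => π * x) π x := by
      simpa using (hasDerivAt_id x).const_mul π
    refine HasDerivAt.congr_deriv ((hl.sin.const_mul (2 / π ^ 2)).sub
      (((hasDerivAt_id' x).mul hl.cos).const_mul (2 / π))) ?_
    field_simp
    ring
  rw [integral_eq_sub_of_hasDerivAt hd (Continuous.intervalIntegrable (by fun_prop) _ _)]
  rw [show π * (1 / 2) = π / 2 by ring]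
  simp

theorem stmt18 (p q k : ℝ) (hp : 1 < p) (hq : 1 < q) (hk0 : 0 ≤ k) (hk1 : k < 1)
    (s : ℝ → ℝ)
    (hmono : StrictMonoOn s (Set.Icc 0 (Kpq p q k)))
    (hmaps : ∀ x ∈ Set.Icc 0 (Kpq p q k), s x ∈ Set.Icc (0:ℝ) 1)
    (hsurj : ∀ y ∈ Set.Icc (0:ℝ) 1, ∃ x ∈ Set.Icc 0 (Kpq p q k), s x = y)
    (hinv : ∀ x ∈ Set.Icc 0 (Kpq p q k), Fpq p q k (s x) = x) :
    4 * ∫ x in (0:ℝ)..(1/2), s (2 * Kpq p q k * x) * Real.sin (π * x) ≥ 8 / π ^ 2 := by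
  have hK : 0 < Kpq p q k := by
    by_contra! h
    obtain ⟨a, ha, ha'⟩ := hsurj 0 (by simp)
    obtain ⟨b, hb, hb'⟩ := hsurj 1 (by simp)
    have hab : a = b := by linarith [ha.1, ha.2, hb.1, hb.2]
    rw [hab, hb'] at ha'
    exact one_ne_zero ha'
  have hfi : IntervalIntegrable (fun t : ℝ => (1 - t ^ q) ^ (-(1 / p)) *
      (1 - k ^ q * t ^ q) ^ (-(1 / (p / (p - 1))))) MeasureTheory.volume 0 1 := by
    by_contra h
    exact hK.ne' (integral_undef h)
  have hmem : ∀ x ∈ Set.Icc (0:ℝ) (1/2), 2 * Kpq p q k * x ∈ Set.Icc 0 (Kpq p q k) := by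
    rintro x ⟨h0, h1⟩
    exact ⟨by positivity, by nlinarith⟩
  have hlow : ∀ x ∈ Set.Icc (0:ℝ) (1/2), 2 * x ≤ s (2 * Kpq p q k * x) := by
    intro x hx
    have hF : Fpq p q k (s (2 * Kpq p q k * x)) ≤ s (2 * Kpq p q k * x) * Kpq p q k :=
      integral_le_mul_integral_of_monotoneOn (monotoneOn_Fpq_integrand hp hq hk0 hk1) hfi
        (hmaps _ (hmem x hx))
    rw [hinv _ (hmem x hx)] at hF
    exact le_of_mul_le_mul_right (by linarith) hK
  have hsint : IntervalIntegrable (fun x => s (2 * Kpq p q k * x) * Real.sin (π * x))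
      MeasureTheory.volume 0 (1/2) := by
    refine IntervalIntegrable.mul_continuousOn (MonotoneOn.intervalIntegrable ?_) (by fun_prop)
    rw [Set.uIcc_of_le (by norm_num)]
    intro a ha b hb hab
    exact hmono.monotoneOn (hmem a ha) (hmem b hb) (by gcongr)
  have hle := integral_mono_on (μ := MeasureTheory.volume) (by norm_num : (0:ℝ) ≤ 1/2)
    (Continuous.intervalIntegrable (by fun_prop : Continuous fun x : ℝ =>
      2 * x * Real.sin (π * x)) _ _) hsint fun x hx =>
      mul_le_mul_of_nonneg_right (hlow x hx) (Real.sin_nonneg_of_nonneg_of_le_pi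
        (mul_nonneg Real.pi_pos.le hx.1) (by nlinarith [hx.2, Real.pi_pos]))
  rw [integral_two_mul_mul_sin_pi_mul] at hle
  calc 8 / π ^ 2 = 4 * (2 / π ^ 2) := by ring
    _ ≤ _ := by linarith
end

section
/- Let p, q ∈ (1,∞) and k ∈ [0,1), and let s denote the inverse of F_{pq,k}, i.e., the strictly increasing bijection s : [0, K_{pq}(k)] → [0,1] with F_{pq,k}(s(x)) = x. Then for every odd positive integer m, |4·∫₀^{1/2} s(2K_{pq}(k)·x)·sin(mπx) dx| < 8·K_{pq}(k)/(m²π²). -/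
open Real intervalIntegral

/-- If `f` vanishes at `0` and has derivative `c * W`, where `W` decreases strictly from `1` to `0`
on `[0, 1/2]`, then its sine integral at a frequency `a` with `cos (a / 2) = 0` is less than
`c / a ^ 2`, also after a change of sign. -/
theorem sign_mul_integral_mul_sin_lt {f W : ℝ → ℝ} {a c σ : ℝ} (hc : 0 < c) (ha : π / 2 < a)
    (hcos : Real.cos (a * (1 / 2)) = 0) (hσ : σ ^ 2 = 1)
    (hf : ContinuousOn f (Set.Icc 0 (1 / 2))) (hW : ContinuousOn W (Set.Icc 0 (1 / 2)))
    (hf' : ∀ x ∈ Set.Ioo (0 : ℝ) (1 / 2), HasDerivAt f (c * W x) x)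
    (hW' : ∀ x ∈ Set.Ioo (0 : ℝ) (1 / 2), ∃ d < 0, HasDerivAt W d x)
    (hf0 : f 0 = 0) (hW0 : W 0 = 1) (hW1 : W (1 / 2) = 0) :
    -(c / a ^ 2) < σ * ∫ x in (0 : ℝ)..(1 / 2), f x * Real.sin (a * x) := by
  have hpi := Real.pi_pos
  have ha0 : 0 < a := by linarith
  set g : ℝ → ℝ := fun x => f x * Real.sin (a * x) with hg
  have hgc : ContinuousOn g (Set.Icc 0 (1 / 2)) := hf.mul (by fun_prop)
  have hgi : IntervalIntegrable g MeasureTheory.volume 0 (1 / 2) :=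
    ContinuousOn.intervalIntegrable_of_Icc (by norm_num) hgc
  set P : ℝ → ℝ := fun x => ∫ t in (0 : ℝ)..x, g t with hP
  have hPc : ContinuousOn P (Set.Icc 0 (1 / 2)) := by
    have h := intervalIntegral.continuousOn_primitive_interval' hgi (a := 0) (by simp)
    rwa [Set.uIcc_of_le (by norm_num)] at h
  have hP' : ∀ x ∈ Set.Ioo (0 : ℝ) (1 / 2), HasDerivAt P (g x) x := by
    intro x hx
    refine intervalIntegral.integral_hasDerivAt_right
      (hgi.mono_set ?_) ?_ (hgc.continuousAt (Icc_mem_nhds hx.1 hx.2))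
    · rw [Set.uIcc_of_le hx.1.le, Set.uIcc_of_le (by norm_num)]
      exact Set.Icc_subset_Icc_right hx.2.le
    · exact (hgc.mono Set.Ioo_subset_Icc_self).stronglyMeasurableAtFilter isOpen_Ioo x hx
  set H : ℝ → ℝ := fun x => W x * (-σ * Real.sin (a * x) - 1)
    + σ * (a ^ 2 / c) * (P x + f x * (Real.cos (a * x) / a)) with hH
  have hHc : ContinuousOn H (Set.Icc 0 (1 / 2)) :=
    (hW.mul (by fun_prop)).add (continuousOn_const.mul (hPc.add (hf.mul (by fun_prop))))
  have hH' : ∀ x ∈ Set.Ioo (0 : ℝ) (1 / 2), ∀ d, HasDerivAt W d x →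
      HasDerivAt H (d * (-σ * Real.sin (a * x) - 1)) x := by
    intro x hx d hd
    have hax : HasDerivAt (fun x : ℝ => a * x) a x := by
      simpa using (hasDerivAt_id x).const_mul a
    have h1 := hd.mul ((hax.sin.const_mul (-σ)).sub_const 1)
    have h2 := ((hP' x hx).add ((hf' x hx).mul (hax.cos.div_const a))).const_mul (σ * (a ^ 2 / c))
    refine (h1.add h2).congr_deriv ?_
    simp only [hg]
    field_simp
    ring
  have hfac : ∀ x, -σ * Real.sin (a * x) - 1 ≤ 0 := by
    intro x
    nlinarith [Real.sin_sq_add_cos_sq (a * x), sq_nonneg (σ + Real.sin (a * x)),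
      sq_nonneg (Real.cos (a * x))]
  have hmono : MonotoneOn H (Set.Icc 0 (1 / 2)) := by
    refine monotoneOn_of_deriv_nonneg (convex_Icc _ _) hHc ?_ ?_
    · intro x hx
      rw [interior_Icc] at hx
      obtain ⟨d, -, hd⟩ := hW' x hx
      exact (hH' x hx d hd).differentiableAt.differentiableWithinAt
    · intro x hx
      rw [interior_Icc] at hx
      obtain ⟨d, hd0, hd⟩ := hW' x hx
      rw [(hH' x hx d hd).deriv]
      exact mul_nonneg_of_nonpos_of_nonpos hd0.le (hfac x)
  have hHl : H 0 = -1 := by simp [hH, hP, hf0, hW0]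
  have hHr : H (1 / 2) = σ * (a ^ 2 / c) * P (1 / 2) := by
    simp only [hH, hW1, hcos]; ring
  have hl : (0 : ℝ) ∈ Set.Icc (0 : ℝ) (1 / 2) := by norm_num
  have hr : (1 / 2 : ℝ) ∈ Set.Icc (0 : ℝ) (1 / 2) := by norm_num
  have hne : H 0 ≠ H (1 / 2) := by
    intro heq
    set x := π / (4 * a) with hxdef
    have hx : x ∈ Set.Ioo (0 : ℝ) (1 / 2) := by
      refine ⟨by positivity, ?_⟩
      rw [hxdef, div_lt_div_iff₀ (by positivity) (by norm_num)]
      linarith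
    obtain ⟨d, hd0, hd⟩ := hW' x hx
    have hconst : H =ᶠ[nhds x] fun _ => H 0 := by
      filter_upwards [Icc_mem_nhds hx.1 hx.2] with y hy
      exact le_antisymm (heq ▸ hmono hy hr hy.2) (hmono hl hy hy.1)
    have hz := (hH' x hx d hd).unique ((hasDerivAt_const x (H 0)).congr_of_eventuallyEq hconst)
    have hs : -σ * Real.sin (a * x) - 1 = 0 := (mul_eq_zero.mp hz).resolve_left hd0.ne
    have hax : a * x = π / 4 := by rw [hxdef]; field_simp
    rw [hax, Real.sin_pi_div_four] at hs
    have h2 : (√2 : ℝ) ^ 2 = 2 := Real.sq_sqrt (by norm_num)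
    have h3 : (σ * (√2 / 2)) ^ 2 = 1 := by
      rw [show σ * (√2 / 2) = -1 by linarith]; norm_num
    rw [mul_pow, hσ, div_pow, h2] at h3
    norm_num at h3
  have hlt := lt_of_le_of_ne (hmono hl hr (by norm_num)) hne
  rw [hHl, hHr] at hlt
  have hm := mul_lt_mul_of_pos_left hlt (show 0 < c / a ^ 2 by positivity)
  have he : c / a ^ 2 * (σ * (a ^ 2 / c) * P (1 / 2)) = σ * P (1 / 2) := by
    field_simp
  rw [he] at hm
  simpa using hm

/-- The product `(1 - y ^ q) ^ α * (1 - κ * y ^ q) ^ β` has negative derivative on `(0, 1)`. -/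
theorem exists_neg_hasDerivAt_rpow_mul_rpow {q α β κ y : ℝ} (hq : 0 < q) (hα : 0 < α) (hβ : 0 ≤ β)
    (hκ0 : 0 ≤ κ) (hκ1 : κ < 1) (hy : y ∈ Set.Ioo (0 : ℝ) 1) :
    ∃ d < 0, HasDerivAt (fun y : ℝ => (1 - y ^ q) ^ α * (1 - κ * y ^ q) ^ β) d y := by
  have hyq0 : 0 < y ^ q := Real.rpow_pos_of_pos hy.1 q
  have hyq1 : y ^ q < 1 := Real.rpow_lt_one hy.1.le hy.2 hq
  have hA : 0 < 1 - y ^ q := by linarith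
  have hB : 0 < 1 - κ * y ^ q := by nlinarith
  have hD := Real.hasDerivAt_rpow_const (x := y) (p := q) (Or.inl hy.1.ne')
  have hDA := (hD.const_sub 1).rpow_const (p := α) (Or.inl hA.ne')
  have hDB := ((hD.const_mul κ).const_sub 1).rpow_const (p := β) (Or.inl hB.ne')
  refine ⟨_, ?_, hDA.mul hDB⟩
  have h1 : 0 < q * y ^ (q - 1) * α * (1 - y ^ q) ^ (α - 1) * (1 - κ * y ^ q) ^ β := by
    have := hy.1
    positivity
  have h2 : 0 ≤ (1 - y ^ q) ^ α * (κ * (q * y ^ (q - 1)) * β * (1 - κ * y ^ q) ^ (β - 1)) := by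
    have := hy.1
    positivity
  linarith

theorem stmt19 (p q k : ℝ) (hp : 1 < p) (hq : 1 < q) (hk0 : 0 ≤ k) (hk1 : k < 1)
    (s : ℝ → ℝ)
    (hmono : StrictMonoOn s (Set.Icc 0 (Kpq p q k)))
    (hmaps : ∀ x ∈ Set.Icc 0 (Kpq p q k), s x ∈ Set.Icc (0:ℝ) 1)
    (hsurj : ∀ y ∈ Set.Icc (0:ℝ) 1, ∃ x ∈ Set.Icc 0 (Kpq p q k), s x = y)
    (hinv : ∀ x ∈ Set.Icc 0 (Kpq p q k), Fpq p q k (s x) = x)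
    (m : ℕ) (hm : Odd m) (hm0 : 0 < m) :
    |4 * ∫ x in (0:ℝ)..(1/2), s (2 * Kpq p q k * x) * Real.sin (m * π * x)|
      < 8 * Kpq p q k / (m ^ 2 * π ^ 2) := by
  set K := Kpq p q k with hK
  have hs0 : s 0 = 0 := by
    obtain ⟨x, hx, hsx⟩ := hsurj 0 (by simp)
    have h := hinv x hx
    rw [hsx, Fpq, intervalIntegral.integral_same] at h
    rw [← h] at hsx
    exact hsx
  have hsK : s K = 1 := by
    obtain ⟨x, hx, hsx⟩ := hsurj 1 (by simp)
    have h := hinv x hx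
    rw [hsx] at h
    rw [show K = x from h, hsx]
  have hK0 : 0 < K := by
    obtain ⟨x, hx, -⟩ := hsurj 1 (by simp)
    refine lt_of_le_of_ne (hx.1.trans hx.2) fun h => ?_
    rw [← h, hs0] at hsK
    exact zero_ne_one hsK
  have hp0 : 0 < p := by linarith
  set α := 1 / p with hα
  set β := 1 / (p / (p - 1)) with hβ
  have hα0 : 0 < α := by positivity
  have hβ0 : 0 < β := by
    have : 0 < p - 1 := by linarith
    positivity
  have hq0 : 0 < q := by linarith
  have hκ0 : 0 ≤ k ^ q := Real.rpow_nonneg hk0 q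
  have hκ1 : k ^ q < 1 := Real.rpow_lt_one hk0 hk1 hq0
  set w : ℝ → ℝ := fun y => (1 - y ^ q) ^ α * (1 - k ^ q * y ^ q) ^ β with hw
  set h : ℝ → ℝ := fun t => (1 - t ^ q) ^ (-α) * (1 - k ^ q * t ^ q) ^ (-β) with hh
  have hwc : Continuous w :=
    ((continuous_const.sub (continuous_id.rpow_const fun _ => Or.inr hq0.le)).rpow_const
      fun _ => Or.inr hα0.le).mul
    ((continuous_const.sub (continuous_const.mul
      (continuous_id.rpow_const fun _ => Or.inr hq0.le))).rpow_const fun _ => Or.inr hβ0.le)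
  have hpos : ∀ y ∈ Set.Ico (0 : ℝ) 1, 0 < 1 - y ^ q ∧ 0 < 1 - k ^ q * y ^ q := by
    intro y hy
    have h0 : 0 ≤ y ^ q := Real.rpow_nonneg hy.1 q
    have h1 : y ^ q < 1 := Real.rpow_lt_one hy.1 hy.2 hq0
    exact ⟨by linarith, by nlinarith⟩
  have hwpos : ∀ y ∈ Set.Ico (0 : ℝ) 1, 0 < w y := fun y hy =>
    mul_pos (Real.rpow_pos_of_pos (hpos y hy).1 _) (Real.rpow_pos_of_pos (hpos y hy).2 _)
  have hhw : ∀ y ∈ Set.Ico (0 : ℝ) 1, h y = (w y)⁻¹ := by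
    intro y hy
    simp only [hh, hw]
    rw [Real.rpow_neg (hpos y hy).1.le, Real.rpow_neg (hpos y hy).2.le, mul_inv]
  have hhi : IntervalIntegrable h MeasureTheory.volume 0 1 := by
    by_contra hn
    have : K = 0 := intervalIntegral.integral_undef hn
    exact hK0.ne' this
  have hhc : ContinuousOn h (Set.Ioo 0 1) :=
    (hwc.continuousOn.inv₀ fun y hy => (hwpos y ⟨hy.1.le, hy.2⟩).ne').congr
      fun y hy => hhw y ⟨hy.1.le, hy.2⟩
  have hF' : ∀ y ∈ Set.Ioo (0 : ℝ) 1, HasDerivAt (Fpq p q k) (w y)⁻¹ y := by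
    intro y hy
    rw [← hhw y ⟨hy.1.le, hy.2⟩]
    refine intervalIntegral.integral_hasDerivAt_right (hhi.mono_set ?_)
      (hhc.stronglyMeasurableAtFilter isOpen_Ioo y hy)
      (hhc.continuousAt (Ioo_mem_nhds hy.1 hy.2))
    rw [Set.uIcc_of_le hy.1.le, Set.uIcc_of_le zero_le_one]
    exact Set.Icc_subset_Icc_right hy.2.le
  have h0mem : (0 : ℝ) ∈ Set.Icc 0 K := ⟨le_rfl, hK0.le⟩
  have hKmem : K ∈ Set.Icc 0 K := ⟨hK0.le, le_rfl⟩
  have hsc : ContinuousOn s (Set.Icc 0 K) := by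
    let r : Set.Icc 0 K → Set.Icc (0 : ℝ) 1 := fun x => ⟨s x, hmaps x x.2⟩
    have hr : Monotone r := fun x y hxy => hmono.monotoneOn x.2 y.2 hxy
    have hrs : Function.Surjective r := fun y => by
      obtain ⟨x, hx, hxy⟩ := hsurj y y.2
      exact ⟨⟨x, hx⟩, Subtype.ext hxy⟩
    rw [continuousOn_iff_continuous_domRestrict]
    exact continuous_subtype_val.comp (hr.continuous_of_surjective hrs)
  have hsIoo : ∀ x ∈ Set.Ioo 0 K, s x ∈ Set.Ioo (0 : ℝ) 1 := fun x hx =>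
    ⟨hs0 ▸ hmono h0mem ⟨hx.1.le, hx.2.le⟩ hx.1, hsK ▸ hmono ⟨hx.1.le, hx.2.le⟩ hKmem hx.2⟩
  have hs' : ∀ x ∈ Set.Ioo 0 K, HasDerivAt s (w (s x)) x := by
    intro x hx
    have hy := hsIoo x hx
    have hd := HasDerivAt.of_local_left_inverse (hsc.continuousAt (Icc_mem_nhds hx.1 hx.2))
      (hF' (s x) hy) (inv_ne_zero (hwpos _ ⟨hy.1.le, hy.2⟩).ne')
      (by filter_upwards [Icc_mem_nhds hx.1 hx.2] with z hz using hinv z hz)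
    rwa [inv_inv] at hd
  have hlin : ∀ x, HasDerivAt (fun x : ℝ => 2 * K * x) (2 * K) x := fun x => by
    simpa using (hasDerivAt_id x).const_mul (2 * K)
  have hmIoo : ∀ x ∈ Set.Ioo (0 : ℝ) (1 / 2), 2 * K * x ∈ Set.Ioo 0 K := fun x hx =>
    ⟨by have := hx.1; positivity, by nlinarith [hx.2]⟩
  have hmIcc : Set.MapsTo (fun x : ℝ => 2 * K * x) (Set.Icc 0 (1 / 2)) (Set.Icc 0 K) := fun x hx =>
    ⟨by have := hx.1; positivity, by dsimp only; nlinarith [hx.2]⟩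
  have hfc : ContinuousOn (fun x => s (2 * K * x)) (Set.Icc 0 (1 / 2)) :=
    hsc.comp (by fun_prop) hmIcc
  have hf' : ∀ x ∈ Set.Ioo (0 : ℝ) (1 / 2),
      HasDerivAt (fun x => s (2 * K * x)) (2 * K * w (s (2 * K * x))) x := by
    intro x hx
    rw [mul_comm (2 * K) (w _)]
    exact (hs' _ (hmIoo x hx)).comp x (hlin x)
  have hm1 : (1 : ℝ) ≤ m := by exact_mod_cast hm0
  have hπ := Real.pi_pos
  have hcos : Real.cos (m * π * (1 / 2)) = 0 := by
    obtain ⟨n, rfl⟩ := hm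
    rw [Real.cos_eq_zero_iff]
    exact ⟨n, by push_cast; ring⟩
  have key : ∀ σ : ℝ, σ ^ 2 = 1 → -(2 * K / (m * π) ^ 2)
      < σ * ∫ x in (0 : ℝ)..(1 / 2), s (2 * K * x) * Real.sin (m * π * x) := by
    intro σ hσ
    refine sign_mul_integral_mul_sin_lt (f := fun x => s (2 * K * x))
      (W := fun x => w (s (2 * K * x))) (by positivity) (by nlinarith) hcos hσ hfc
      (hwc.comp_continuousOn hfc) hf' ?_ (by simp [hs0]) ?_ ?_
    · intro x hx
      have hy := hsIoo _ (hmIoo x hx)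
      obtain ⟨d, hd0, hd⟩ := exists_neg_hasDerivAt_rpow_mul_rpow hq0 hα0 hβ0.le hκ0 hκ1 hy
      exact ⟨_, mul_neg_of_neg_of_pos hd0 (mul_pos (mul_pos two_pos hK0) (hwpos _ ⟨hy.1.le, hy.2⟩)),
        HasDerivAt.comp (h₂ := w) x hd (hf' x hx)⟩
    · simp [hw, hs0, Real.zero_rpow hq0.ne']
    · have hhalf : s (2 * K * (1 / 2)) = 1 := by
        rw [show 2 * K * (1 / 2) = K by ring, hsK]
      simp only [hhalf]
      simp [hw, Real.zero_rpow hα0.ne']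
  have h1 := key 1 (by norm_num)
  have h2 := key (-1) (by norm_num)
  have he : 8 * K / ((m : ℝ) ^ 2 * π ^ 2) = 4 * (2 * K / (m * π) ^ 2) := by
    rw [mul_pow]; ring
  rw [he, abs_lt]
  constructor <;> linarith
end
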